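/- arXiv:math/0207192 — 2 statements merged into one kernel-verified Lean document; each statement's English description precedes it below -/
import Mathlib

section
/- Let k ≥ 3 and n ≥ k−1. Then A_k(n, k) − A_k(n−1, k) = A_{k−2}(n−4, k−2) + A_{k−1}(n−4, k−2). -/
/-- A permutation `α` of `{1,…,n}` (as `Equiv.Perm (Fin n)`, 0-indexed) contains the
pattern given in one-line notation by the list `w`: there are increasing positions
whose values are order-isomorphic to `w`. -/
def ContainsPattern {n : ℕ} (α : Equiv.Perm (Fin n)) (w : List ℕ) : Prop :=
  ∃ f : Fin w.length → Fin n, StrictMono f ∧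
    ∀ a b : Fin w.length, w.get a < w.get b ↔ α (f a) < α (f b)

/-- `α` avoids the pattern `w`. -/
def AvoidsPattern {n : ℕ} (α : Equiv.Perm (Fin n)) (w : List ℕ) : Prop :=
  ¬ ContainsPattern α w

/-- The pattern of length `2k` (in one-line notation, on values `1,…,2k`) beginning with
`a, k+2, k+3, …, 2k−1`, followed by `1, 2k` (if `sep = true`) or by `2k` (if `sep = false`),
and ending with the remaining elements of `{1,…,2k}` in increasing order. -/
def gonPattern (k a : ℕ) (sep : Bool) : List ℕ :=
  let pre : List ℕ := a :: (List.range' (k+2) (k-2) ++ (if sep then [1, 2*k] else [2*k]))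
  pre ++ ((List.range' 1 (2*k)).filter (fun x => !(pre.contains x)))

/-- `π` is a 321-`k`-gon-avoiding permutation: it avoids `321` and the four
patterns of `𝔓_k`. -/
def Avoids321Gon (k : ℕ) {n : ℕ} (π : Equiv.Perm (Fin n)) : Prop :=
  AvoidsPattern π [3, 2, 1] ∧
    AvoidsPattern π (gonPattern k k true) ∧ AvoidsPattern π (gonPattern k k false) ∧
    AvoidsPattern π (gonPattern k (k+1) true) ∧ AvoidsPattern π (gonPattern k (k+1) false)

/-- `f_k(n)`: the number of 321-`k`-gon-avoiding permutations of `{1,…,n}`. -/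
noncomputable def fgon (k n : ℕ) : ℕ :=
  Nat.card {π : Equiv.Perm (Fin n) // Avoids321Gon k π}

/-- `π` starts (in one-line notation on values `1,…,n`) with the entries listed in `l`,
i.e. `π(1) = l₁, π(2) = l₂, …`. -/
def StartsWith {n : ℕ} (π : Equiv.Perm (Fin n)) (l : List ℕ) : Prop :=
  ∀ (j : Fin l.length) (hj : (j : ℕ) < n), ((π ⟨j, hj⟩ : Fin n) : ℕ) + 1 = l.get j

/-- `f_k(n; i₁,…,i_m)`: the number of 321-`k`-gon-avoiding permutations of `{1,…,n}`
starting with `i₁ i₂ ⋯ i_m` (given as the list `l`). -/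
noncomputable def fstart (k n : ℕ) (l : List ℕ) : ℕ :=
  Nat.card {π : Equiv.Perm (Fin n) // Avoids321Gon k π ∧ StartsWith π l}

/-- `A_d(n,m) = Σ_{d ≤ i₁ < ⋯ < i_m ≤ n} f_k(n; i₁,…,i_m)`. -/
noncomputable def Aseq (k d n m : ℕ) : ℕ :=
  ∑ s ∈ (Finset.Icc d n).powersetCard m, fstart k n (s.sort (· ≤ ·))

/-- `B_d(n,m) = Σ_{d+1 ≤ i₁ < ⋯ < i_m ≤ n} f_k(n; d, i₁,…,i_m)`. -/
noncomputable def Bseq (k d n m : ℕ) : ℕ :=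
  ∑ s ∈ (Finset.Icc (d+1) n).powersetCard m, fstart k n (d :: s.sort (· ≤ ·))

/-- `C_d(n,m) = Σ_{d ≤ i₁ < ⋯ < i_m ≤ n} f_k(n; i₁,…,i_m, 1)`. -/
noncomputable def Cseq (k d n m : ℕ) : ℕ :=
  ∑ s ∈ (Finset.Icc d n).powersetCard m, fstart k n (s.sort (· ≤ ·) ++ [1])

/-- `L_n^k(s) = Σ_{j=0}^{s} (−1)^j C(s−j, j) f_k(n−j)`. -/
noncomputable def Lgon (k n s : ℕ) : ℤ :=
  ∑ j ∈ Finset.range (s+1), (-1 : ℤ)^j * ((s-j).choose j : ℤ) * (fgon k (n-j) : ℤ)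

/-- The one-line notation of a permutation of `Fin n` as a function on `ℕ`, fixing everything
outside `{0,…,n-1}`. -/
def natVal {n : ℕ} (π : Equiv.Perm (Fin n)) (p : ℕ) : ℕ :=
  if h : p < n then (π ⟨p, h⟩ : ℕ) else p

/-- `v` restricts to a permutation of `{0,…,n-1}`. -/
structure IsPermBelow (n : ℕ) (v : ℕ → ℕ) : Prop where
  lt : ∀ p < n, v p < n
  inj : ∀ p < n, ∀ q < n, v p = v q → p = q
  surj : ∀ y < n, ∃ p < n, v p = y

theorem natVal_fin {n : ℕ} (π : Equiv.Perm (Fin n)) (p : Fin n) : natVal π p = π p := by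
  simp [natVal]

theorem isPermBelow_natVal {n : ℕ} (π : Equiv.Perm (Fin n)) : IsPermBelow n (natVal π) where
  lt p hp := by simp [natVal, hp]
  inj p hp q hq h := by
    simpa [natVal, hp, hq, Fin.val_inj] using h
  surj y hy := ⟨π.symm ⟨y, hy⟩, (π.symm ⟨y, hy⟩).2, by simp [natVal_fin]⟩

/-- A decreasing subsequence of length three. -/
def HasDesc (n : ℕ) (v : ℕ → ℕ) : Prop :=
  ∃ p q r, p < q ∧ q < r ∧ r < n ∧ v r < v q ∧ v q < v p

/-- Two increasing sequences of `k` positions, the values at `b` being big and those at `s`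
small, such that big entries precede and exceed small ones, except possibly that `s 0` precedes
the last big entry and that the last small entry exceeds `v (b 0)`. -/
structure IsGon (k n : ℕ) (v b s : ℕ → ℕ) : Prop where
  b_lt : ∀ i < k, b i < n
  s_lt : ∀ i < k, s i < n
  b_mono : ∀ i j, i < j → j < k → b i < b j
  s_mono : ∀ i j, i < j → j < k → s i < s j
  vb_mono : ∀ i j, i < j → j < k → v (b i) < v (b j)
  vs_mono : ∀ i j, i < j → j < k → v (s i) < v (s j)
  pos : ∀ i j, i < k → j < k → i + 1 < k ∨ 0 < j → b i < s j
  val : ∀ i j, i < k → j < k → 0 < i ∨ j + 1 < k → v (s j) < v (b i)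

theorem containsPattern_map_range {n : ℕ} (π : Equiv.Perm (Fin n)) (L : ℕ) (w : ℕ → ℕ) :
    ContainsPattern π ((List.range L).map w) ↔
      ∃ f : ℕ → ℕ, (∀ i < L, f i < n) ∧ (∀ i j, i < j → j < L → f i < f j) ∧
        ∀ i j, i < L → j < L → (w i < w j ↔ natVal π (f i) < natVal π (f j)) := by
  have hlen : ((List.range L).map w).length = L := by simp
  constructor
  · rintro ⟨f, hf, hv⟩
    refine ⟨fun i => if h : i < L then f ⟨i, by simpa using h⟩ else 0, ?_, ?_, ?_⟩
    · intro i hi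
      simp [hi]
    · intro i j hij hj
      simp only [hj, hij.trans hj, dif_pos]
      exact hf (by simpa using hij)
    · intro i j hi hj
      simp only [hj, hi, dif_pos, natVal_fin]
      simpa using hv ⟨i, by simpa using hi⟩ ⟨j, by simpa using hj⟩
  · rintro ⟨f, hlt, hf, hv⟩
    refine ⟨fun i => ⟨f i, hlt i (i.2.trans_eq hlen)⟩, ?_, ?_⟩
    · intro i j hij
      exact hf i j hij (j.2.trans_eq hlen)
    · intro i j
      have := hv i j (i.2.trans_eq hlen) (j.2.trans_eq hlen)
      have h1 := hlt i (i.2.trans_eq hlen)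
      have h2 := hlt j (j.2.trans_eq hlen)
      simpa [natVal, h1, h2] using this

/-- The `i`-th big entry of a pattern of `𝔓_k`. -/
def bigEntry (k a i : ℕ) : ℕ := if i = 0 then a else k + 1 + i

/-- The `j`-th small entry of a pattern of `𝔓_k`. -/
def smallEntry (k a j : ℕ) : ℕ := if j + 1 = k then 2 * k + 1 - a else j + 1

/-- The entry at position `t` of a pattern of `𝔓_k`. -/
def gonEntry (k a : ℕ) (sep : Bool) (t : ℕ) : ℕ :=
  if sep then
    if t + 1 < k then bigEntry k a t else if t + 1 = k then smallEntry k a 0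
    else if t = k then bigEntry k a (k - 1) else smallEntry k a (t - k)
  else if t < k then bigEntry k a t else smallEntry k a (t - k)

theorem filter_not_mem_pre (m a : ℕ) (ha : a = m + 2 ∨ a = m + 3) (z : List ℕ)
    (hz : ∀ x, x ∈ z ↔ x = 2 * (m + 2)) :
    (List.range' 1 (2 * (m + 2))).filter
      (fun x => !((a :: (List.range' (m + 4) m ++ z)).contains x)) =
      List.range' 1 (m + 1) ++ [2 * (m + 2) + 1 - a] := by
  have hsplit : List.range' 1 (2 * (m + 2)) =
      List.range' 1 (m + 1) ++ ([m + 2, m + 3] ++ List.range' (m + 4) (m + 1)) := by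
    have h2 : [m + 2, m + 3] = List.range' (m + 2) 2 := by simp [List.range'_succ]
    rw [h2, show m + 4 = (m + 2) + 1 * 2 by omega, List.range'_append,
      show m + 2 = 1 + 1 * (m + 1) by omega, List.range'_append]
    congr 1; omega
  rw [hsplit, List.filter_append, List.filter_append]
  have e1 : (List.range' 1 (m + 1)).filter
      (fun x => !((a :: (List.range' (m + 4) m ++ z)).contains x)) = List.range' 1 (m + 1) := by
    rw [List.filter_eq_self]
    intro x hx
    simp [List.mem_range'_1, hz] at hx ⊢
    omega
  have e3 : (List.range' (m + 4) (m + 1)).filter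
      (fun x => !((a :: (List.range' (m + 4) m ++ z)).contains x)) = [] := by
    rw [List.filter_eq_nil_iff]
    intro x hx
    simp [List.mem_range'_1, hz] at hx ⊢
    omega
  have e2 : [m + 2, m + 3].filter
      (fun x => !((a :: (List.range' (m + 4) m ++ z)).contains x)) =
        [2 * (m + 2) + 1 - a] := by
    rcases ha with rfl | rfl
    · have : 2 * (m + 2) + 1 - (m + 2) = m + 3 := by omega
      rw [this]
      simp [List.mem_range'_1, hz]
      omega
    · have : 2 * (m + 2) + 1 - (m + 3) = m + 2 := by omega
      rw [this]
      simp [List.mem_range'_1, hz]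
  rw [e1, e2, e3]
  simp

theorem filter_not_mem_pre_sep (m a : ℕ) (ha : a = m + 2 ∨ a = m + 3) (hm : 0 < m) :
    (List.range' 1 (2 * (m + 2))).filter
      (fun x => !((a :: (List.range' (m + 4) m ++ [1, 2 * (m + 2)])).contains x)) =
      List.range' 2 m ++ [2 * (m + 2) + 1 - a] := by
  have h : (fun x => !((a :: (List.range' (m + 4) m ++ [1, 2 * (m + 2)])).contains x)) =
      fun x => decide (x ≠ 1) &&
        !((a :: (List.range' (m + 4) m ++ [2 * (m + 2)])).contains x) := by
    funext x
    rw [Bool.eq_iff_iff]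
    simp
    tauto
  rw [h, ← List.filter_filter, filter_not_mem_pre m a ha _ (by simp), List.filter_append,
    List.range'_succ, List.filter_cons]
  have e1 : (List.range' (1 + 1) m).filter (fun x => decide (x ≠ 1)) = List.range' 2 m := by
    rw [List.filter_eq_self]
    intro x hx
    simp [List.mem_range'_1] at hx ⊢
    omega
  rw [e1]
  have : 2 * (m + 2) + 1 - a ≠ 1 := by omega
  simp [this]

theorem gonPattern_eq_map (k a : ℕ) (hk : 3 ≤ k) (ha : a = k ∨ a = k + 1) (sep : Bool) :
    gonPattern k a sep = (List.range (2 * k)).map (gonEntry k a sep) := by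
  obtain ⟨m, rfl⟩ : ∃ m, k = m + 2 := ⟨k - 2, by omega⟩
  cases sep
  · simp only [gonPattern, Bool.false_eq_true, if_false, Nat.add_sub_cancel]
    rw [show m + 2 + 2 = m + 4 by rfl, filter_not_mem_pre m a ha _ (by simp)]
    apply List.ext_getElem
    · simp; omega
    · intro t h1 h2
      simp only [List.length_map, List.length_range] at h2
      simp [List.getElem_append, List.getElem_cons, gonEntry, bigEntry, smallEntry]
      split_ifs <;> omega
  · simp only [gonPattern, if_true, Nat.add_sub_cancel]
    rw [show m + 2 + 2 = m + 4 by rfl, filter_not_mem_pre_sep m a ha (by omega)]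
    apply List.ext_getElem
    · simp; omega
    · intro t h1 h2
      simp only [List.length_map, List.length_range] at h2
      simp [List.getElem_append, List.getElem_cons, gonEntry, bigEntry, smallEntry]
      split_ifs <;> omega

theorem bigEntry_lt_bigEntry {k a : ℕ} (ha : a = k ∨ a = k + 1) (i j : ℕ) :
    bigEntry k a i < bigEntry k a j ↔ i < j := by
  unfold bigEntry; split_ifs <;> omega

theorem smallEntry_lt_smallEntry {k a i j : ℕ} (ha : a = k ∨ a = k + 1) (hi : i < k)
    (hj : j < k) : smallEntry k a i < smallEntry k a j ↔ i < j := by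
  unfold smallEntry; split_ifs <;> omega

theorem smallEntry_lt_bigEntry {k a i j : ℕ} (ha : a = k ∨ a = k + 1) (hi : i < k)
    (hj : j < k) : smallEntry k a j < bigEntry k a i ↔ (0 < i ∨ j + 1 < k ∨ a = k + 1) := by
  unfold smallEntry bigEntry; split_ifs <;> omega

theorem bigEntry_ne_smallEntry {k a i j : ℕ} (ha : a = k ∨ a = k + 1) (hi : i < k)
    (hj : j < k) : bigEntry k a i ≠ smallEntry k a j := by
  unfold smallEntry bigEntry; split_ifs <;> omega

/-- Position in a pattern of `𝔓_k` of the `i`-th big entry. -/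
def bigPos (k : ℕ) (sep : Bool) (i : ℕ) : ℕ := if sep ∧ i + 1 = k then k else i

/-- Position in a pattern of `𝔓_k` of the `j`-th small entry. -/
def smallPos (k : ℕ) (sep : Bool) (j : ℕ) : ℕ := if sep ∧ j = 0 then k - 1 else k + j

theorem gonEntry_bigPos {k a i : ℕ} (sep : Bool) (hi : i < k) :
    gonEntry k a sep (bigPos k sep i) = bigEntry k a i := by
  cases sep
  · simp [gonEntry, bigPos, hi]
  · by_cases h : i + 1 = k
    · subst h
      simp [gonEntry, bigPos]
    · have : i + 1 < k := by omega
      simp [gonEntry, bigPos, h, this]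

theorem gonEntry_smallPos {k a j : ℕ} (sep : Bool) (hj : j < k) :
    gonEntry k a sep (smallPos k sep j) = smallEntry k a j := by
  cases sep
  · simp [gonEntry, smallPos]
  · by_cases h : j = 0
    · subst h
      have : k - 1 + 1 = k := by omega
      simp [gonEntry, smallPos, this]
    · have h1 : ¬ k + j + 1 < k := by omega
      have h2 : ¬ k + j + 1 = k := by omega
      simp [gonEntry, smallPos, h, h1, h2]

theorem eq_bigPos_or_smallPos {k t : ℕ} (sep : Bool) (ht : t < 2 * k) :
    (∃ i < k, t = bigPos k sep i) ∨ ∃ j < k, t = smallPos k sep j := by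
  cases sep
  · by_cases h : t < k
    · exact .inl ⟨t, h, by simp [bigPos]⟩
    · exact .inr ⟨t - k, by omega, by simp [smallPos]; omega⟩
  · by_cases h : t + 1 < k
    · exact .inl ⟨t, by omega, by simp [bigPos]; omega⟩
    · by_cases h1 : t + 1 = k
      · exact .inr ⟨0, by omega, by simp [smallPos]; omega⟩
      · by_cases h2 : t = k
        · exact .inl ⟨k - 1, by omega, by simp [bigPos]; split_ifs <;> omega⟩
        · exact .inr ⟨t - k, by omega, by simp [smallPos]; split_ifs <;> omega⟩

theorem isGon_of_containsPattern {k n a : ℕ} {π : Equiv.Perm (Fin n)} {sep : Bool} (hk : 3 ≤ k)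
    (ha : a = k ∨ a = k + 1) (h : ContainsPattern π (gonPattern k a sep)) :
    ∃ b s, IsGon k n (natVal π) b s := by
  rw [gonPattern_eq_map k a hk ha, containsPattern_map_range] at h
  obtain ⟨f, hlt, hf, hv⟩ := h
  have hb : ∀ i < k, bigPos k sep i < 2 * k := by
    intro i hi; unfold bigPos; split_ifs <;> omega
  have hs : ∀ i < k, smallPos k sep i < 2 * k := by
    intro i hi; unfold smallPos; split_ifs <;> omega
  refine ⟨fun i => f (bigPos k sep i), fun j => f (smallPos k sep j), ?_, ?_, ?_, ?_, ?_, ?_, ?_,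
    ?_⟩
  · exact fun i hi => hlt _ (hb i hi)
  · exact fun i hi => hlt _ (hs i hi)
  · intro i j hij hj
    refine hf _ _ ?_ (hb j hj)
    unfold bigPos; split_ifs <;> omega
  · intro i j hij hj
    refine hf _ _ ?_ (hs j hj)
    unfold smallPos; split_ifs <;> omega
  · intro i j hij hj
    rwa [← hv _ _ (hb i (hij.trans hj)) (hb j hj), gonEntry_bigPos _ (hij.trans hj),
      gonEntry_bigPos _ hj, bigEntry_lt_bigEntry ha]
  · intro i j hij hj
    rwa [← hv _ _ (hs i (hij.trans hj)) (hs j hj), gonEntry_smallPos _ (hij.trans hj),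
      gonEntry_smallPos _ hj, smallEntry_lt_smallEntry ha (hij.trans hj) hj]
  · intro i j hi hj hij
    refine hf _ _ ?_ (hs j hj)
    unfold bigPos smallPos; split_ifs <;> omega
  · intro i j hi hj hij
    rw [← hv _ _ (hs j hj) (hb i hi), gonEntry_bigPos _ hi, gonEntry_smallPos _ hj,
      smallEntry_lt_bigEntry ha hi hj]
    omega

theorem IsGon.containsPattern {k n : ℕ} {π : Equiv.Perm (Fin n)} {b s : ℕ → ℕ} (hk : 3 ≤ k)
    (h : IsGon k n (natVal π) b s) :
    ∃ a sep, (a = k ∨ a = k + 1) ∧ ContainsPattern π (gonPattern k a sep) := by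
  set v := natVal π with hvdef
  have hinj := (isPermBelow_natVal π).inj
  obtain ⟨a, ha, hav⟩ : ∃ a, (a = k ∨ a = k + 1) ∧ (v (s (k - 1)) < v (b 0) ↔ a = k + 1) := by
    by_cases h : v (s (k - 1)) < v (b 0)
    · exact ⟨k + 1, by simp, by simp [h]⟩
    · exact ⟨k, by simp, by simp [h]⟩
  obtain ⟨sep, hsep⟩ : ∃ sep : Bool, sep = true ↔ s 0 < b (k - 1) :=
    ⟨decide (s 0 < b (k - 1)), by simp⟩
  refine ⟨a, sep, ha, ?_⟩
  rw [gonPattern_eq_map k a hk ha, containsPattern_map_range]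
  obtain ⟨f, hf⟩ : ∃ f : ℕ → ℕ, ∀ t, f t = if sep then
      if t + 1 < k then b t else if t + 1 = k then s 0 else if t = k then b (k - 1) else s (t - k)
    else if t < k then b t else s (t - k) := ⟨_, fun _ => rfl⟩
  have hfb : ∀ i < k, f (bigPos k sep i) = b i := by
    intro i hi
    cases sep
    · simp [hf, bigPos, hi]
    · by_cases h : i + 1 = k
      · subst h
        simp [hf, bigPos]
      · have : i + 1 < k := by omega
        simp [hf, bigPos, h, this]
  have hfs : ∀ j < k, f (smallPos k sep j) = s j := by
    intro j hj
    cases sep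
    · simp [hf, smallPos]
    · by_cases h : j = 0
      · subst h
        have : k - 1 + 1 = k := by omega
        simp [hf, smallPos, this]
      · have h1 : ¬ k + j + 1 < k := by omega
        have h2 : ¬ k + j + 1 = k := by omega
        simp [hf, smallPos, h, h1, h2]
  have hpos : ∀ i j, i < k → j < k → (bigPos k sep i < smallPos k sep j → b i < s j) ∧
      (smallPos k sep j < bigPos k sep i → s j < b i) := by
    intro i j hi hj
    by_cases hij : i + 1 < k ∨ 0 < j
    · have := h.pos i j hi hj hij
      refine ⟨fun _ => this, ?_⟩
      grind [bigPos, smallPos]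
    · obtain rfl : i = k - 1 := by omega
      obtain rfl : j = 0 := by omega
      have hne : b (k - 1) ≠ s 0 := by
        intro e
        have h1 := h.val (k - 1) 0 hi hj (by omega)
        rw [e] at h1
        exact lt_irrefl _ h1
      by_cases hsb : s 0 < b (k - 1)
      · have hsep : sep = true := hsep.2 hsb
        refine ⟨?_, fun _ => hsb⟩
        grind [bigPos, smallPos]
      · have hsep : sep = false := by rwa [← Bool.not_eq_true, hsep]
        refine ⟨fun _ => by omega, ?_⟩
        grind [bigPos, smallPos]
  have hvbb : ∀ i j, i < k → j < k → (v (b i) < v (b j) ↔ i < j) := by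
    intro i j hi hj
    rcases lt_trichotomy i j with hij | rfl | hij
    · exact ⟨fun _ => hij, fun _ => h.vb_mono i j hij hj⟩
    · simp
    · have := h.vb_mono j i hij hi
      omega
  have hvss : ∀ i j, i < k → j < k → (v (s i) < v (s j) ↔ i < j) := by
    intro i j hi hj
    rcases lt_trichotomy i j with hij | rfl | hij
    · exact ⟨fun _ => hij, fun _ => h.vs_mono i j hij hj⟩
    · simp
    · have := h.vs_mono j i hij hi
      omega
  have hvsb : ∀ i j, i < k → j < k →
      (v (s j) < v (b i) ↔ (0 < i ∨ j + 1 < k ∨ a = k + 1)) := by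
    intro i j hi hj
    by_cases hij : 0 < i ∨ j + 1 < k
    · have := h.val i j hi hj hij
      exact iff_of_true this (by tauto)
    · obtain rfl : i = 0 := by omega
      obtain rfl : j = k - 1 := by omega
      rw [hav]
      omega
  have hvne : ∀ i j, i < k → j < k → v (b i) ≠ v (s j) := by
    intro i j hi hj e
    have e' := hinj _ (h.b_lt i hi) _ (h.s_lt j hj) e
    by_cases hij : i + 1 < k ∨ 0 < j
    · have := h.pos i j hi hj hij
      omega
    · have := h.val i j hi hj (by omega)
      omega
  refine ⟨f, ?_, ?_, ?_⟩
  · intro t ht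
    rcases eq_bigPos_or_smallPos sep ht with ⟨i, hi, rfl⟩ | ⟨i, hi, rfl⟩
    · rw [hfb i hi]; exact h.b_lt i hi
    · rw [hfs i hi]; exact h.s_lt i hi
  · intro t u htu hu
    rcases eq_bigPos_or_smallPos sep (htu.trans hu) with ⟨i, hi, rfl⟩ | ⟨i, hi, rfl⟩ <;>
    rcases eq_bigPos_or_smallPos sep hu with ⟨j, hj, rfl⟩ | ⟨j, hj, rfl⟩
    · rw [hfb i hi, hfb j hj]
      refine h.b_mono i j ?_ hj
      grind [bigPos]
    · rw [hfb i hi, hfs j hj]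
      exact (hpos i j hi hj).1 htu
    · rw [hfb j hj, hfs i hi]
      exact (hpos j i hj hi).2 htu
    · rw [hfs i hi, hfs j hj]
      refine h.s_mono i j ?_ hj
      grind [smallPos]
  · intro t u ht hu
    rcases eq_bigPos_or_smallPos sep ht with ⟨i, hi, rfl⟩ | ⟨i, hi, rfl⟩ <;>
    rcases eq_bigPos_or_smallPos sep hu with ⟨j, hj, rfl⟩ | ⟨j, hj, rfl⟩
    · rw [hfb i hi, hfb j hj, gonEntry_bigPos _ hi, gonEntry_bigPos _ hj,
        bigEntry_lt_bigEntry ha, hvbb i j hi hj]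
    · rw [hfb i hi, hfs j hj, gonEntry_bigPos _ hi, gonEntry_smallPos _ hj]
      have h1 := smallEntry_lt_bigEntry ha hi hj
      have h2 := hvsb i j hi hj
      have h3 := bigEntry_ne_smallEntry ha hi hj
      have h4 := hvne i j hi hj
      change _ ↔ v (b i) < v (s j)
      rw [← h1] at h2
      omega
    · rw [hfb j hj, hfs i hi, gonEntry_bigPos _ hj, gonEntry_smallPos _ hi,
        smallEntry_lt_bigEntry ha hj hi, hvsb j i hj hi]
    · rw [hfs i hi, hfs j hj, gonEntry_smallPos _ hi, gonEntry_smallPos _ hj,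
        smallEntry_lt_smallEntry ha hi hj, hvss i j hi hj]

theorem containsPattern_321_iff {n : ℕ} (π : Equiv.Perm (Fin n)) :
    ContainsPattern π [3, 2, 1] ↔ HasDesc n (natVal π) := by
  have e : [3, 2, 1] = (List.range 3).map (fun t => 3 - t) := by decide
  rw [e, containsPattern_map_range]
  constructor
  · rintro ⟨f, hlt, hf, hv⟩
    exact ⟨f 0, f 1, f 2, hf 0 1 (by simp) (by simp), hf 1 2 (by simp) (by simp), hlt 2 (by simp),
      (hv 2 1 (by simp) (by simp)).1 (by simp), (hv 1 0 (by simp) (by simp)).1 (by simp)⟩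
  · rintro ⟨p, q, r, hpq, hqr, hr, h1, h2⟩
    refine ⟨fun t => if t = 0 then p else if t = 1 then q else r, ?_, ?_, ?_⟩
    · intro i _
      dsimp only
      split_ifs <;> omega
    · intro i j _ _
      dsimp only
      split_ifs <;> omega
    · intro i j _ _
      dsimp only
      split_ifs <;> omega

/-- Avoidance of `321` and of all four patterns of `𝔓_k`. -/
structure GoodBelow (k n : ℕ) (v : ℕ → ℕ) : Prop where
  desc : ¬ HasDesc n v
  gon : ∀ b s, ¬ IsGon k n v b s

theorem avoids321Gon_iff {k n : ℕ} (hk : 3 ≤ k) (π : Equiv.Perm (Fin n)) :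
    Avoids321Gon k π ↔ GoodBelow k n (natVal π) := by
  unfold Avoids321Gon AvoidsPattern
  rw [containsPattern_321_iff]
  constructor
  · rintro ⟨h0, h1, h2, h3, h4⟩
    refine ⟨h0, fun b s hg => ?_⟩
    obtain ⟨a, sep, ha | ha, h⟩ := hg.containsPattern hk <;> subst ha <;> cases sep <;>
      contradiction
  · rintro ⟨h0, hg⟩
    have key : ∀ a sep, (a = k ∨ a = k + 1) → ¬ ContainsPattern π (gonPattern k a sep) := by
      intro a sep ha h
      obtain ⟨b, s, h⟩ := isGon_of_containsPattern hk ha h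
      exact hg b s h
    exact ⟨h0, key _ _ (by simp), key _ _ (by simp), key _ _ (by simp), key _ _ (by simp)⟩

/-- The first `m` entries increase and are at least `d` (for 1-based values). -/
structure IncStart (d n m : ℕ) (v : ℕ → ℕ) : Prop where
  le : m ≤ n
  mono : ∀ i j, i < j → j < m → v i < v j
  ge : ∀ i < m, d ≤ v i + 1

theorem startsWith_iff {n : ℕ} (π : Equiv.Perm (Fin n)) (l : List ℕ) (hl : l.length ≤ n) :
    StartsWith π l ↔ l = (List.range l.length).map (fun i => natVal π i + 1) := by
  constructor
  · intro h
    apply List.ext_getElem (by simp)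
    intro i h1 h2
    have := h ⟨i, h1⟩ (by simpa using h1.trans_le hl)
    simp [natVal, h1.trans_le hl] at this ⊢
    exact this.symm
  · intro h j hj
    have : l[(j : ℕ)] = ((List.range l.length).map (fun i => natVal π i + 1))[(j : ℕ)]'(by simp) :=
      List.getElem_of_eq h _
    simp [natVal, hj] at this
    simp [this]

theorem Aseq_eq_card {k d n m : ℕ} (hk : 3 ≤ k) (hd : 1 ≤ d) :
    Aseq k d n m = Nat.card {π : Equiv.Perm (Fin n) //
      GoodBelow k n (natVal π) ∧ IncStart d n m (natVal π)} := by
  classical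
  let F : Equiv.Perm (Fin n) → Finset ℕ := fun π =>
    ((List.range m).map (fun i => natVal π i + 1)).toFinset
  have hsorted : ∀ π : Equiv.Perm (Fin n), (∀ i j, i < j → j < m → natVal π i < natVal π j) →
      ((List.range m).map (fun i => natVal π i + 1)).Pairwise (· < ·) := by
    intro π h
    rw [List.pairwise_map]
    refine List.Pairwise.imp_of_mem ?_ (List.pairwise_lt_range (n := m))
    intro a b _ hb hab
    have := h a b hab (by simpa using hb)
    omega
  rw [Nat.card_eq_fintype_card, Fintype.card_subtype,
    Finset.card_eq_sum_card_fiberwise (f := F) (t := (Finset.Icc d n).powersetCard m)]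
  · unfold Aseq
    refine Finset.sum_congr rfl fun s hs => ?_
    rw [Finset.mem_powersetCard] at hs
    have hmn : m ≤ n := by
      have := Finset.card_le_card hs.1
      rw [Nat.card_Icc] at this
      omega
    have hlen : (s.sort (· ≤ ·)).length = m := by simp [hs.2]
    unfold fstart
    rw [Nat.card_eq_fintype_card, Fintype.card_subtype]
    congr 1
    ext π
    simp only [Finset.mem_filter, Finset.mem_univ, true_and]
    rw [startsWith_iff π _ (by omega), hlen, avoids321Gon_iff hk, and_assoc]
    refine and_congr_right fun _ => ?_
    constructor
    · intro h
      have hpw : ((List.range m).map (fun i => natVal π i + 1)).Pairwise (· < ·) := by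
        rw [← h]; exact s.sortedLT_sort.pairwise
      refine ⟨⟨hmn, ?_, ?_⟩, ?_⟩
      · intro i j hij hj
        have := List.pairwise_iff_getElem.1 hpw i j (by simp; omega) (by simpa using hj) hij
        simpa using this
      · intro i hi
        have : natVal π i + 1 ∈ s := by
          rw [← Finset.mem_sort (· ≤ ·), h]
          exact List.mem_map.2 ⟨i, by simpa using hi, rfl⟩
        exact (Finset.mem_Icc.1 (hs.1 this)).1
      · simp only [F]
        rw [← h, Finset.sort_toFinset]
    · rintro ⟨hinc, hF⟩
      have hpw := hsorted π hinc.mono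
      rw [← hF]
      simp only [F]
      rw [List.toFinset_sort]
      · exact hpw.imp le_of_lt
      · exact hpw.imp ne_of_lt
  · intro π hπ
    simp only [Finset.coe_filter, Finset.mem_univ, true_and, Set.mem_ofPred_eq] at hπ
    obtain ⟨-, hinc⟩ := hπ
    simp only [Finset.mem_coe, Finset.mem_powersetCard, F]
    refine ⟨?_, ?_⟩
    · intro x hx
      simp only [List.mem_toFinset, List.mem_map, List.mem_range] at hx
      obtain ⟨i, hi, rfl⟩ := hx
      have := (isPermBelow_natVal π).lt i (hi.trans_le hinc.le)
      have := hinc.ge i hi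
      simp; omega
    · rw [List.toFinset_card_of_nodup]
      · simp
      · exact (hsorted π hinc.mono).imp ne_of_lt

/-- Permutations with prescribed entries outside the positions `e i` correspond to permutations of
the positions `e i`; `f` is one permutation with the prescribed entries. -/
theorem card_perm_eq_of_prescribed {N M : ℕ} (e f : ℕ → ℕ) (he : ∀ i < N, e i < M)
    (he_inj : ∀ i < N, ∀ j < N, e i = e j → i = j) (hf : ∀ p < M, f p < M)
    (hf_inj : ∀ p < M, ∀ q < M, f p = f q → p = q) (P Q : (ℕ → ℕ) → Prop)
    (hP : ∀ π : Equiv.Perm (Fin M), P (natVal π) →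
      ∀ p < M, (∀ i < N, e i ≠ p) → natVal π p = f p)
    (h : ∀ (π : Equiv.Perm (Fin M)) (σ : Equiv.Perm (Fin N)),
      (∀ i < N, natVal π (e i) = f (e (natVal σ i))) →
      (∀ p < M, (∀ i < N, e i ≠ p) → natVal π p = f p) → (P (natVal π) ↔ Q (natVal σ))) :
    Nat.card {π : Equiv.Perm (Fin M) // P (natVal π)} =
      Nat.card {σ : Equiv.Perm (Fin N) // Q (natVal σ)} := by
  classical
  let E : Fin N ↪ Fin M :=
    ⟨fun i => ⟨e i, he i i.2⟩, fun i j hij => Fin.ext (he_inj i i.2 j j.2 (by simpa using hij))⟩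
  let f₀ : Equiv.Perm (Fin M) := Equiv.ofBijective (fun p => ⟨f p, hf p p.2⟩)
    (Finite.injective_iff_bijective.1 fun p q hpq =>
      Fin.ext (hf_inj p p.2 q q.2 (by simpa using hpq)))
  let Φ : Equiv.Perm (Fin N) → Equiv.Perm (Fin M) := fun σ => f₀ * σ.viaFintypeEmbedding E
  have hE : ∀ p : Fin M, (∀ i < N, e i ≠ p) ↔ p ∉ Set.range E := by
    intro p
    constructor
    · rintro h ⟨i, rfl⟩
      exact h i i.2 rfl
    · intro h i hi hp
      exact h ⟨⟨i, hi⟩, Fin.ext hp⟩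
  have hΦ1 : ∀ σ, ∀ i < N, natVal (Φ σ) (e i) = f (e (natVal σ i)) := by
    intro σ i hi
    have h1 : natVal (Φ σ) (e i) = Φ σ (E ⟨i, hi⟩) := natVal_fin (Φ σ) (E ⟨i, hi⟩)
    have h2 : natVal σ i = σ ⟨i, hi⟩ := natVal_fin σ ⟨i, hi⟩
    rw [h1, h2]
    simp only [Φ, Equiv.Perm.mul_apply, Equiv.Perm.viaFintypeEmbedding_apply_image]
    rfl
  have hΦ2 : ∀ σ, ∀ p < M, (∀ i < N, e i ≠ p) → natVal (Φ σ) p = f p := by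
    intro σ p hp hne
    have h1 : natVal (Φ σ) p = Φ σ ⟨p, hp⟩ := natVal_fin (Φ σ) ⟨p, hp⟩
    have h2 := (hE ⟨p, hp⟩).1 hne
    rw [h1]
    simp only [Φ, Equiv.Perm.mul_apply, Equiv.Perm.viaFintypeEmbedding_apply_notMem_range _ _ h2]
    rfl
  have hΦ : ∀ σ, P (natVal (Φ σ)) ↔ Q (natVal σ) := fun σ => h _ _ (hΦ1 σ) (hΦ2 σ)
  refine (Nat.card_congr (Equiv.ofBijective
    (fun σ : {σ : Equiv.Perm (Fin N) // Q (natVal σ)} =>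
      (⟨Φ σ, (hΦ σ).2 σ.2⟩ : {π : Equiv.Perm (Fin M) // P (natVal π)})) ⟨?_, ?_⟩)).symm
  · rintro ⟨σ, hσ⟩ ⟨τ, hτ⟩ hστ
    have h1 : Φ σ = Φ τ := by simpa using hστ
    have h2 := mul_left_cancel h1
    refine Subtype.ext (Equiv.ext fun i => E.injective ?_)
    have := congrArg (fun ρ : Equiv.Perm (Fin M) => ρ (E i)) h2
    simpa only [Equiv.Perm.viaFintypeEmbedding_apply_image] using this
  · rintro ⟨π, hπ⟩
    have hfix : ∀ p, p ∉ Set.range E → π p = f₀ p := by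
      intro p hp
      have := hP π hπ p p.2 ((hE p).2 hp)
      rw [natVal_fin] at this
      exact Fin.ext this
    have hmem : ∀ i, f₀.symm (π (E i)) ∈ Set.range E := by
      intro i
      by_contra hn
      have h1 := hfix _ hn
      rw [Equiv.apply_symm_apply] at h1
      rw [π.injective h1] at hn
      exact hn ⟨i, rfl⟩
    choose g hg using hmem
    have hginj : Function.Injective g := by
      intro i j hij
      have : f₀.symm (π (E i)) = f₀.symm (π (E j)) := by rw [← hg, ← hg, hij]
      exact E.injective (π.injective (f₀.symm.injective this))
    let σ : Equiv.Perm (Fin N) := Equiv.ofBijective g (Finite.injective_iff_bijective.1 hginj)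
    have hσ : Φ σ = π := by
      ext p : 1
      by_cases hp : p ∈ Set.range E
      · obtain ⟨i, rfl⟩ := hp
        simp only [Φ, Equiv.Perm.mul_apply, Equiv.Perm.viaFintypeEmbedding_apply_image]
        change f₀ (E (g i)) = _
        rw [hg, Equiv.apply_symm_apply]
      · simp only [Φ, Equiv.Perm.mul_apply,
          Equiv.Perm.viaFintypeEmbedding_apply_notMem_range _ _ hp]
        exact (hfix p hp).symm
    exact ⟨⟨σ, (hΦ σ).1 (by rw [hσ]; exact hπ)⟩, Subtype.ext hσ⟩

theorem add_sub_le_of_strictMono_below {k : ℕ} {x : ℕ → ℕ} (h : ∀ i j, i < j → j < k → x i < x j)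
    {i j : ℕ} (hij : i ≤ j) (hj : j < k) : x i + (j - i) ≤ x j := by
  induction j, hij using Nat.le_induction with
  | base => simp
  | succ j hij ih =>
    have := ih (by omega)
    have := h j (j + 1) (by omega) hj
    omega

theorem IsPermBelow.exists_inv {n : ℕ} {v : ℕ → ℕ} (hv : IsPermBelow n v) :
    ∃ w : ℕ → ℕ, ∀ y < n, w y < n ∧ v (w y) = y := by
  choose! w hw using hv.surj
  exact ⟨w, hw⟩

theorem GoodBelow.not_desc {k n : ℕ} {v : ℕ → ℕ} (hg : GoodBelow k n v) {p q r : ℕ} (hpq : p < q)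
    (hqr : q < r) (hr : r < n) (hv : v q < v p) : v q ≤ v r := by
  by_contra hlt
  exact hg.desc ⟨p, q, r, hpq, hqr, hr, by omega, hv⟩

/-- `u` is the pattern of `v` at the positions `e 0 < ⋯ < e (N - 1)`. -/
structure IsSubpattern (N M : ℕ) (u v e : ℕ → ℕ) : Prop where
  lt : ∀ i < N, e i < M
  pos : ∀ i < N, ∀ j < N, (e i < e j ↔ i < j)
  val : ∀ i < N, ∀ j < N, (v (e i) < v (e j) ↔ u i < u j)

theorem IsSubpattern.good {k N M : ℕ} {u v e : ℕ → ℕ} (h : IsSubpattern N M u v e)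
    (hg : GoodBelow k M v) : GoodBelow k N u := by
  refine ⟨?_, ?_⟩
  · rintro ⟨p, q, r, hpq, hqr, hr, h1, h2⟩
    have hq := hqr.trans hr
    have hp := hpq.trans hq
    exact hg.desc ⟨e p, e q, e r, (h.pos p hp q hq).2 hpq, (h.pos q hq r hr).2 hqr, h.lt r hr,
      (h.val r hr q hq).2 h1, (h.val q hq p hp).2 h2⟩
  · intro b s G
    refine hg.gon (fun i => e (b i)) (fun i => e (s i)) ⟨?_, ?_, ?_, ?_, ?_, ?_, ?_, ?_⟩
    · exact fun i hi => h.lt _ (G.b_lt i hi)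
    · exact fun i hi => h.lt _ (G.s_lt i hi)
    · exact fun i j hij hj =>
        (h.pos _ (G.b_lt i (hij.trans hj)) _ (G.b_lt j hj)).2 (G.b_mono i j hij hj)
    · exact fun i j hij hj =>
        (h.pos _ (G.s_lt i (hij.trans hj)) _ (G.s_lt j hj)).2 (G.s_mono i j hij hj)
    · exact fun i j hij hj =>
        (h.val _ (G.b_lt i (hij.trans hj)) _ (G.b_lt j hj)).2 (G.vb_mono i j hij hj)
    · exact fun i j hij hj =>
        (h.val _ (G.s_lt i (hij.trans hj)) _ (G.s_lt j hj)).2 (G.vs_mono i j hij hj)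
    · exact fun i j hi hj hij =>
        (h.pos _ (G.b_lt i hi) _ (G.s_lt j hj)).2 (G.pos i j hi hj hij)
    · exact fun i j hi hj hij =>
        (h.val _ (G.s_lt j hj) _ (G.b_lt i hi)).2 (G.val i j hi hj hij)

theorem IsSubpattern.hasDesc {N M : ℕ} {u v e : ℕ → ℕ} (h : IsSubpattern N M u v e)
    {p q r : ℕ} (hpq : p < q) (hqr : q < r) (hrq : v r < v q) (hqp : v q < v p)
    (hp : ∃ x < N, e x = p) (hq : ∃ x < N, e x = q) (hr : ∃ x < N, e x = r) : HasDesc N u := by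
  obtain ⟨p, hp, rfl⟩ := hp
  obtain ⟨q, hq, rfl⟩ := hq
  obtain ⟨r, hr, rfl⟩ := hr
  exact ⟨p, q, r, (h.pos p hp q hq).1 hpq, (h.pos q hq r hr).1 hqr, hr, (h.val r hr q hq).1 hrq,
    (h.val q hq p hp).1 hqp⟩

theorem IsSubpattern.isGon {k N M : ℕ} {u v e b s : ℕ → ℕ} (h : IsSubpattern N M u v e)
    (G : IsGon k M v b s) (hb : ∀ i < k, ∃ x < N, e x = b i) (hs : ∀ i < k, ∃ x < N, e x = s i) :
    ∃ b' s', IsGon k N u b' s' := by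
  choose! b' hb' heb using hb
  choose! s' hs' hes using hs
  refine ⟨b', s', hb', hs', ?_, ?_, ?_, ?_, ?_, ?_⟩
  · intro i j hij hj
    have hi := hij.trans hj
    rw [← h.pos _ (hb' i hi) _ (hb' j hj), heb i hi, heb j hj]
    exact G.b_mono i j hij hj
  · intro i j hij hj
    have hi := hij.trans hj
    rw [← h.pos _ (hs' i hi) _ (hs' j hj), hes i hi, hes j hj]
    exact G.s_mono i j hij hj
  · intro i j hij hj
    have hi := hij.trans hj
    rw [← h.val _ (hb' i hi) _ (hb' j hj), heb i hi, heb j hj]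
    exact G.vb_mono i j hij hj
  · intro i j hij hj
    have hi := hij.trans hj
    rw [← h.val _ (hs' i hi) _ (hs' j hj), hes i hi, hes j hj]
    exact G.vs_mono i j hij hj
  · intro i j hi hj hij
    rw [← h.pos _ (hb' i hi) _ (hs' j hj), heb i hi, hes j hj]
    exact G.pos i j hi hj hij
  · intro i j hi hj hij
    rw [← h.val _ (hs' j hj) _ (hb' i hi), heb i hi, hes j hj]
    exact G.val i j hi hj hij

/-- The small entries `0, …, k-2, t` of a permutation whose first `k` entries increase and are at
least `k-1` appear in increasing order after the first `k` entries. -/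
theorem exists_small_positions {k n t d : ℕ} {v : ℕ → ℕ} (hv : IsPermBelow n v)
    (hg : GoodBelow k n v) (hi : IncStart k n k v) (hd : d < k) (ht : k - 1 ≤ t) (htd : t < v d)
    (htk : ∀ i < k, v i ≠ t) :
    ∃ s : ℕ → ℕ, (∀ j < k, s j < n ∧ k ≤ s j) ∧ (∀ i j, i < j → j < k → s i < s j) ∧
      (∀ j, j + 1 < k → v (s j) = j) ∧ v (s (k - 1)) = t := by
  obtain ⟨w, hw⟩ := hv.exists_inv
  have hdn := hv.lt d (hd.trans_le hi.le)
  have hkn := hi.le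
  have hwt := hw t (by omega)
  have h0 := hi.ge 0 (by omega)
  have hwt_ge : k ≤ w t := by
    by_contra hlt
    exact htk (w t) (by omega) hwt.2
  have hw_ge : ∀ j, j + 1 < k → k ≤ w j := by
    intro j hj
    by_contra hlt
    have h1 := hi.ge (w j) (by omega)
    have h2 := hw j (by omega)
    omega
  refine ⟨fun j => if j + 1 = k then w t else w j, ?_, ?_, ?_, ?_⟩
  · intro j hj
    dsimp only
    split_ifs with h
    · exact ⟨hwt.1, hwt_ge⟩
    · exact ⟨(hw j (by omega)).1, hw_ge j (by omega)⟩
  · intro i j hij hj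
    have hwi := hw i (by omega)
    have hwig := hw_ge i (by omega)
    have hne : i + 1 ≠ k := by omega
    simp only [hne, if_false]
    split_ifs with h
    · by_contra hlt
      have hne : w t ≠ w i := fun e => by rw [e] at hwt; omega
      have := hg.not_desc (p := d) (q := w t) (r := w i) (by omega) (by omega) hwi.1 (by omega)
      omega
    · by_contra hlt
      have hwj := hw j (by omega)
      have hwjg := hw_ge j (by omega)
      have hne : w j ≠ w i := fun e => by rw [e] at hwj; omega
      have := hg.not_desc (p := 0) (q := w j) (r := w i) (by omega) (by omega) hwi.1 (by omega)
      omega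
  · intro j hj
    have : j + 1 ≠ k := by omega
    simp only [this, if_false]
    exact (hw j (by omega)).2
  · have : k - 1 + 1 = k := by omega
    simp only [this, if_true]
    exact hwt.2

theorem first_two_entries {k n : ℕ} {v : ℕ → ℕ} (hk : 3 ≤ k) (hv : IsPermBelow n v)
    (hg : GoodBelow k n v) (hi : IncStart k n k v) : v 0 = k - 1 ∧ v 1 = k := by
  have key : ∀ t, k - 1 ≤ t → t < v 1 → (∀ i < k, v i ≠ t) → False := by
    intro t ht ht1 htk
    obtain ⟨s, hs, hsm, hsv, hst⟩ := exists_small_positions hv hg hi (by omega) ht ht1 htk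
    have hval : ∀ j < k, v (s j) = if j + 1 = k then t else j := by
      intro j hj
      split_ifs with h
      · rw [← hst]; congr 2; omega
      · exact hsv j (by omega)
    have hkn := hi.le
    refine hg.gon id s ⟨?_, ?_, ?_, hsm, hi.mono, ?_, ?_, ?_⟩
    · intro i hi; simp; omega
    · exact fun j hj => (hs j hj).1
    · intro i j hij _; simpa using hij
    · intro i j hij hj
      rw [hval i (by omega), hval j hj]
      split_ifs <;> omega
    · intro i j hik hj _
      have := (hs j hj).2
      simp; omega
    · intro i j hik hj hij
      rw [hval j hj]
      have h0 := hi.ge 0 (by omega)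
      have h1 : i = 0 ∨ v 0 < v i := by
        rcases Nat.eq_zero_or_pos i with h | h
        · exact .inl h
        · exact .inr (hi.mono 0 i h hik)
      have h2 : i = 0 ∨ i = 1 ∨ v 1 < v i := by
        rcases Nat.lt_or_ge 1 i with h | h
        · exact .inr (.inr (hi.mono 1 i h hik))
        · omega
      simp only [id]
      split_ifs
      · rcases h2 with rfl | rfl | h2 <;> omega
      · rcases h1 with rfl | h1 <;> omega
  have h0 := hi.ge 0 (by omega)
  have h01 := hi.mono 0 1 (by omega) (by omega)
  have h0' : v 0 = k - 1 := by
    by_contra hne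
    refine key (k - 1) le_rfl (by omega) fun i hik => ?_
    rcases Nat.eq_zero_or_pos i with rfl | h
    · exact hne
    · have := hi.mono 0 i h hik
      omega
  refine ⟨h0', ?_⟩
  by_contra hne
  refine key k (by omega) (by omega) fun i hik => ?_
  rcases Nat.lt_or_ge 1 i with h | h
  · have := hi.mono 1 i h hik
    omega
  · obtain rfl | rfl : i = 0 ∨ i = 1 := by omega
    · omega
    · exact hne

/-- If the third entry is not the smallest possible one, no further big entry precedes the
entry `1`. -/
theorem no_big_entry_before_one {k n c : ℕ} {v : ℕ → ℕ} (hk : 3 ≤ k) (hv : IsPermBelow n v)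
    (hg : GoodBelow k n v) (hi : IncStart k n k v) (h2 : k + 2 ≤ v 2) (hcn : c < n) (hkc : k ≤ c)
    (hvc : v (k - 1) < v c) (hc1 : ∀ p < n, v p = 1 → c < p) : False := by
  obtain ⟨h0, h1⟩ := first_two_entries hk hv hg hi
  have hkn := hi.le
  have htk : ∀ i < k, v i ≠ k + 1 := by
    intro i hik
    rcases Nat.lt_or_ge 2 i with h | h
    · have := hi.mono 2 i h hik
      omega
    · obtain rfl | rfl | rfl : i = 0 ∨ i = 1 ∨ i = 2 := by omega
      all_goals omega
  obtain ⟨s, hs, hsm, hsv, hst⟩ :=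
    exists_small_positions hv hg hi (d := 2) (t := k + 1) (by omega) (by omega) (by omega) htk
  have hval : ∀ j < k, v (s j) = if j + 1 = k then k + 1 else j := by
    intro j hj
    split_ifs with h
    · rw [← hst]; congr 2; omega
    · exact hsv j (by omega)
  have hcs : ∀ j < k, 0 < j → c < s j := by
    intro j hj hj0
    have h1 := hc1 (s 1) (hs 1 (by omega)).1 (hsv 1 (by omega))
    rcases Nat.lt_or_ge 1 j with h | h
    · have := hsm 1 j h hj
      omega
    · obtain rfl : j = 1 := by omega
      exact h1
  refine hg.gon (fun i => if i + 1 = k then c else i + 1) s ⟨?_, ?_, ?_, hsm, ?_, ?_, ?_, ?_⟩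
  · intro i hi; split_ifs <;> omega
  · exact fun j hj => (hs j hj).1
  · intro i j hij _; split_ifs <;> omega
  · intro i j hij hj
    have hik : i + 1 ≠ k := by omega
    simp only [hik, if_false]
    split_ifs with h
    · rcases Nat.lt_or_ge (i + 1) (k - 1) with h' | h'
      · exact (hi.mono _ _ h' (by omega)).trans hvc
      · rwa [show i + 1 = k - 1 by omega]
    · exact hi.mono _ _ (by omega) (by omega)
  · intro i j hij hj
    rw [hval i (by omega), hval j hj]
    split_ifs <;> omega
  · intro i j hik hj hij
    have := (hs j hj).2
    have := hcs j hj
    split_ifs <;> omega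
  · intro i j hik hj hij
    rw [hval j hj]
    have hmono : ∀ i < k, 1 < i → k + 2 ≤ v i := by
      intro i hik h
      rcases Nat.lt_or_ge 2 i with h | h
      · have := hi.mono 2 i h hik
        omega
      · obtain rfl : i = 2 := by omega
        exact h2
    have := hmono (k - 1) (by omega) (by omega)
    by_cases hik' : i + 1 = k
    · simp only [hik', if_true]
      split_ifs <;> omega
    · simp only [hik', if_false]
      have h' := hmono (i + 1) (by omega)
      rcases Nat.eq_zero_or_pos i with rfl | hpos
      · simp only [Nat.zero_add, h1]
        split_ifs <;> omega
      · split_ifs <;> omega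

theorem next_entries_of_third_ne {k n : ℕ} {v : ℕ → ℕ} (hk : 3 ≤ k) (hn : k + 1 < n)
    (hv : IsPermBelow n v) (hg : GoodBelow k n v) (hi : IncStart k n k v) (h2 : v 2 ≠ k + 1) :
    v k = 0 ∧ v (k + 1) = 1 := by
  obtain ⟨h0, h1⟩ := first_two_entries hk hv hg hi
  have h12 := hi.mono 1 2 (by omega) (by omega)
  have h2' : k + 2 ≤ v 2 := by omega
  have hlast : 1 < v (k - 1) := by
    have := hi.mono 1 (k - 1) (by omega) (by omega)
    omega
  have hpos : ∀ p < n, v p < k - 1 → k ≤ p := by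
    intro p hp hvp
    by_contra hlt
    have := hi.ge p (by omega)
    omega
  obtain ⟨w, hw⟩ := hv.exists_inv
  obtain ⟨hw0, hvw0⟩ := hw 0 (by omega)
  obtain ⟨hw1, hvw1⟩ := hw 1 (by omega)
  have hw0k := hpos (w 0) hw0 (by omega)
  have hw1k := hpos (w 1) hw1 (by omega)
  have hw01 : w 0 < w 1 := by
    by_contra hlt
    have hne : w 1 ≠ w 0 := fun e => by rw [e] at hvw1; omega
    have := hg.not_desc (p := 0) (q := w 1) (r := w 0) (by omega) (by omega) hw0 (by omega)
    omega
  have hw1u : ∀ p < n, v p = 1 → p = w 1 := fun p hp h => hv.inj p hp _ hw1 (by omega)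
  have key : ∀ c, k ≤ c → c < w 1 → c ≠ w 0 → False := by
    intro c hkc hc1 hc0
    have hne : v c ≠ v (w 1) := fun e => by
      have := hv.inj c (by omega) _ hw1 e; omega
    have hne0 : v c ≠ v (w 0) := fun e => hc0 (hv.inj c (by omega) _ hw0 e)
    have hne' : v c ≠ v (k - 1) := fun e => by
      have := hv.inj c (by omega) _ (by omega) e; omega
    refine no_big_entry_before_one hk hv hg hi h2' (c := c) (by omega) hkc ?_ ?_
    · by_contra hlt
      have := hg.not_desc (p := k - 1) (q := c) (r := w 1) (by omega) hc1 hw1 (by omega)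
      omega
    · intro p hp h
      rw [hw1u p hp h]
      exact hc1
  have hk0 : w 0 = k := by
    by_contra hne
    exact key k le_rfl (by omega) (by omega)
  have hk1 : w 1 = k + 1 := by
    by_contra hne
    exact key (k + 1) (by omega) (by omega) (by omega)
  rw [hk0] at hvw0
  rw [hk1] at hvw1
  exact ⟨hvw0, hvw1⟩

/-- The inequalities satisfied by a gon in a permutation starting with `k-1, k`. -/
theorem IsGon.bounds {k n : ℕ} {v b s : ℕ → ℕ} (hk : 3 ≤ k) (hn : 2 < n) (hv : IsPermBelow n v)
    (h0 : v 0 = k - 1) (h1 : v 1 = k) (G : IsGon k n v b s) :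
    (∀ i < k, b 0 + i ≤ b i ∧ k - 1 ≤ v (b i) ∧ b i < n) ∧
    (∀ j < k, s 0 + j ≤ s j ∧ v (s 0) + j ≤ v (s j) ∧ k ≤ s 0 + 1 ∧ s j < n) ∧
    k + 2 ≤ v (b 1) ∧ v (s (k - 2)) < v (b 0) ∧ v (s (k - 2)) ≠ k - 1 ∧ v (s (k - 2)) ≠ k := by
  have hb : ∀ i < k, b 0 + i ≤ b i := fun i hi => by
    simpa using add_sub_le_of_strictMono_below G.b_mono (Nat.zero_le i) hi
  have hs : ∀ i < k, s 0 + i ≤ s i := fun i hi => by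
    simpa using add_sub_le_of_strictMono_below G.s_mono (Nat.zero_le i) hi
  have hvs : ∀ i < k, v (s 0) + i ≤ v (s i) := fun i hi => by
    simpa using add_sub_le_of_strictMono_below (x := fun i => v (s i)) G.vs_mono (Nat.zero_le i) hi
  have hs0 : k ≤ s 0 + 1 := by
    have := G.pos (k - 2) 0 (by omega) (by omega) (by omega)
    have := hb (k - 2) (by omega)
    omega
  have hne : ∀ j < k, v (s j) ≠ k - 1 ∧ v (s j) ≠ k := by
    intro j hj
    have hsj := hs j hj
    have hlt := G.s_lt j hj
    constructor
    · intro e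
      have := hv.inj _ hlt 0 (by omega) (by omega)
      omega
    · intro e
      have := hv.inj _ hlt 1 (by omega) (by omega)
      omega
  refine ⟨fun i hi => ⟨hb i hi, ?_, G.b_lt i hi⟩, fun j hj => ⟨hs j hj, hvs j hj, hs0, G.s_lt j hj⟩,
    ?_, G.val 0 (k - 2) (by omega) (by omega) (by omega), hne (k - 2) (by omega)⟩
  · have := G.val i (k - 2) hi (by omega) (by omega)
    have := hvs (k - 2) (by omega)
    omega
  · have := G.val 1 (k - 1) (by omega) (by omega) (by omega)
    have := hvs (k - 1) (by omega)
    have := hne (k - 1) (by omega)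
    omega

/-- Comparing the entries of `v` at the positions `e i` with those of `u`. -/
theorem IsSubpattern.of_eq {N M : ℕ} {u v e g : ℕ → ℕ}
    (he : ∀ i < N, e i < M) (he_mono : ∀ i j, i < j → e i < e j)
    (hg_mono : ∀ i j, i < j → g i < g j) (h : ∀ i < N, v (e i) = g (u i)) :
    IsSubpattern N M u v e := by
  have hes : StrictMono e := fun i j => he_mono i j
  have hgs : StrictMono g := fun i j => hg_mono i j
  refine ⟨he, fun i _ j _ => hes.lt_iff_lt, fun i hi j hj => ?_⟩
  rw [h i hi, h j hj, hgs.lt_iff_lt]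

/-- Inserting the entries `k-1, k` at the front and `0, 1` after the first `k` positions. -/
theorem good_iff_insert_zero_one {k N : ℕ} {u v : ℕ → ℕ} (hk : 3 ≤ k) (hN : k - 2 ≤ N)
    (hv : IsPermBelow (N + 4) v) (h0 : v 0 = k - 1) (h1 : v 1 = k)
    (hvk : v k = 0) (hvk1 : v (k + 1) = 1)
    (he : ∀ i < N, v (if i < k - 2 then i + 2 else i + 4) =
      if u i < k - 3 then u i + 2 else u i + 4) :
    GoodBelow k (N + 4) v ∧ IncStart k (N + 4) k v ↔
      GoodBelow k N u ∧ IncStart (k - 2) N (k - 2) u := by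
  have hsub : IsSubpattern N (N + 4) u v (fun i => if i < k - 2 then i + 2 else i + 4) := by
    refine IsSubpattern.of_eq (g := fun x => if x < k - 3 then x + 2 else x + 4) ?_ ?_ ?_ he
    · intro i hi; split_ifs <;> omega
    · intro i j hij; split_ifs <;> omega
    · intro i j hij; split_ifs <;> omega
  have hfirst : ∀ i < k - 2, v (i + 2) = if u i < k - 3 then u i + 2 else u i + 4 := by
    intro i hi
    have := he i (by omega)
    rwa [if_pos hi] at this
  constructor
  · rintro ⟨hg, hi⟩
    refine ⟨hsub.good hg, hN, ?_, ?_⟩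
    · intro i j hij hj
      have := hi.mono (i + 2) (j + 2) (by omega) (by omega)
      rw [hfirst i (by omega), hfirst j hj] at this
      split_ifs at this <;> omega
    · intro i hik
      have := hi.mono 1 (i + 2) (by omega) (by omega)
      rw [hfirst i hik] at this
      split_ifs at this <;> omega
  · rintro ⟨hg, hi⟩
    have hbig : ∀ i < k - 2, k + 1 ≤ v (i + 2) := by
      intro i hik
      have := hi.ge i hik
      rw [hfirst i hik]
      split_ifs <;> omega
    have hbig' : ∀ i < k, 2 ≤ i → k + 1 ≤ v i := by
      intro i hik h
      have := hbig (i - 2) (by omega)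
      rwa [show i - 2 + 2 = i by omega] at this
    have hinc : IncStart k (N + 4) k v := by
      refine ⟨by omega, ?_, ?_⟩
      · intro i j hij hj
        rcases Nat.lt_or_ge i 2 with h | h
        · rcases Nat.lt_or_ge j 2 with h' | h'
          · obtain rfl : i = 0 := by omega
            obtain rfl : j = 1 := by omega
            omega
          · have := hbig' j hj h'
            obtain rfl | rfl : i = 0 ∨ i = 1 := by omega
            all_goals omega
        · obtain ⟨i, rfl⟩ : ∃ x, i = x + 2 := ⟨i - 2, by omega⟩
          obtain ⟨j, rfl⟩ : ∃ x, j = x + 2 := ⟨j - 2, by omega⟩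
          have := hi.mono i j (by omega) (by omega)
          rw [hfirst i (by omega), hfirst j (by omega)]
          split_ifs <;> omega
      · intro i hik
        rcases Nat.lt_or_ge i 2 with h | h
        · obtain rfl | rfl : i = 0 ∨ i = 1 := by omega
          all_goals omega
        · have := hbig' i hik h
          omega
    have hmem : ∀ p < N + 4, 2 ≤ p → p ≠ k → p ≠ k + 1 →
        ∃ x < N, (if x < k - 2 then x + 2 else x + 4) = p := by
      intro p hp hp2 hpk hpk1
      rcases Nat.lt_or_ge p k with h | h
      · exact ⟨p - 2, by omega, by split_ifs <;> omega⟩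
      · exact ⟨p - 4, by omega, by split_ifs <;> omega⟩
    refine ⟨⟨?_, ?_⟩, hinc⟩
    · rintro ⟨p, q, r, hpq, hqr, hr, hrq, hqp⟩
      have hpk : p ≠ k := by rintro rfl; omega
      have hpk1 : p ≠ k + 1 := by
        rintro rfl
        have : q ≠ k := by omega
        have := hv.inj q (by omega) k (by omega)
        omega
      have hqk : q ≠ k := by rintro rfl; omega
      have hqk1 : q ≠ k + 1 := by
        rintro rfl
        have := hv.inj r (by omega) k (by omega)
        omega
      have hqge : k ≤ q := by
        by_contra hlt
        have := hinc.mono p q hpq (by omega)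
        omega
      have hq := hmem q (by omega) (by omega) hqk hqk1
      have hr := hmem r hr (by omega) (by omega) (by omega)
      rcases Nat.lt_or_ge p 2 with h | h
      · have hvp : v p ≤ k := by
          obtain rfl | rfl : p = 0 ∨ p = 1 := by omega
          all_goals omega
        have := hbig' 2 (by omega) le_rfl
        exact hg.desc (hsub.hasDesc (p := 2) (by omega) hqr hrq (by omega)
          (hmem 2 (by omega) le_rfl (by omega) (by omega)) hq hr)
      · exact hg.desc (hsub.hasDesc hpq hqr hrq hqp (hmem p (by omega) h hpk hpk1) hq hr)
    · intro b s G
      obtain ⟨hb, hs, hb1, hlt, hne, hne'⟩ := G.bounds hk (by omega) hv h0 h1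
      have hbk : ∀ i < k, b i ≠ k ∧ b i ≠ k + 1 := by
        intro i hik
        have := (hb i hik).2.1
        constructor <;> intro e <;> rw [e] at this <;> omega
      have hb0 : 2 ≤ b 0 := by
        by_contra hb0
        have hvb0 : v (b 0) ≤ k := by
          obtain h | h : b 0 = 0 ∨ b 0 = 1 := by omega
          all_goals rw [h]; omega
        have hs1 : v (s 1) = 1 := by
          have h1 := hs 1 (by omega)
          have h2 := add_sub_le_of_strictMono_below (x := fun i => v (s i)) G.vs_mono
            (show 1 ≤ k - 2 by omega) (by omega)
          omega
        have hs1' : s 1 = k + 1 :=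
          hv.inj _ (G.s_lt 1 (by omega)) _ (by omega) (by omega)
        have h3 := G.pos (k - 1) 1 (by omega) (by omega) (by omega)
        have h4 := (hbk (k - 1) (by omega)).1
        have h5 := add_sub_le_of_strictMono_below G.b_mono (show 1 ≤ k - 1 by omega) (by omega)
        have h6 := hb 1 (by omega)
        have h7 : b 1 = 1 := by omega
        rw [h7] at hb1
        omega
      have hs0 : k + 2 ≤ s 0 := by
        have h3 := G.pos (k - 2) 0 (by omega) (by omega) (by omega)
        have h4 := (hbk (k - 2) (by omega)).1
        have h5 := hb (k - 2) (by omega)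
        omega
      obtain ⟨b', s', G'⟩ := hsub.isGon G
        (fun i hik => hmem _ (hb i hik).2.2 (by have := hb i hik; omega) (hbk i hik).1 (hbk i hik).2)
        (fun j hj => by
          have := hs j hj
          exact hmem _ this.2.2.2 (by omega) (by omega) (by omega))
      exact hg.gon b' s' G'

/-- Inserting the entries `k-1, k, k+1` at the front and `0` after the first `k` positions. -/
theorem good_iff_insert_zero {k N : ℕ} {u v : ℕ → ℕ} (hk : 3 ≤ k) (hN : k - 2 ≤ N)
    (hv : IsPermBelow (N + 4) v) (h0 : v 0 = k - 1) (h1 : v 1 = k)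
    (h2 : v 2 = k + 1) (hvk : v k = 0)
    (he : ∀ i < N, v (if i < k - 3 then i + 3 else i + 4) =
      if u i < k - 2 then u i + 1 else u i + 4) :
    (GoodBelow k (N + 4) v ∧ IncStart k (N + 4) k v) ∧ v (k + 1) ≠ 1 ↔
      GoodBelow k N u ∧ IncStart (k - 1) N (k - 2) u := by
  have hsub : IsSubpattern N (N + 4) u v (fun i => if i < k - 3 then i + 3 else i + 4) := by
    refine IsSubpattern.of_eq (g := fun x => if x < k - 2 then x + 1 else x + 4) ?_ ?_ ?_ he
    · intro i hi; split_ifs <;> omega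
    · intro i j hij; split_ifs <;> omega
    · intro i j hij; split_ifs <;> omega
  have hfirst : ∀ i < k - 3, v (i + 3) = if u i < k - 2 then u i + 1 else u i + 4 := by
    intro i hi
    have := he i (by omega)
    rwa [if_pos hi] at this
  have hlast : v (k + 1) = if u (k - 3) < k - 2 then u (k - 3) + 1 else u (k - 3) + 4 := by
    have := he (k - 3) (by omega)
    rwa [if_neg (lt_irrefl _), show k - 3 + 4 = k + 1 by omega] at this
  constructor
  · rintro ⟨⟨hg, hi⟩, hvk1⟩
    have hinc : ∀ i < k, v i < v (k + 1) := by
      obtain ⟨p, hp, hp1⟩ := hv.surj 1 (by omega)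
      have hpk : k + 1 < p := by
        by_contra hlt
        rcases Nat.lt_or_ge p k with h | h
        · have := hi.ge p h
          omega
        · obtain rfl | rfl : p = k ∨ p = k + 1 := by omega
          all_goals omega
      have hne : v (k + 1) ≠ 0 := fun e => by
        have := hv.inj (k + 1) (by omega) k (by omega) (by omega)
        omega
      intro i hik
      have hne' : v (k + 1) ≠ v i := fun e => by
        have := hv.inj (k + 1) (by omega) i (by omega) (by omega)
        omega
      by_contra hlt
      have := hg.not_desc (p := i) (q := k + 1) (r := p) (by omega) hpk hp (by omega)
      omega
    refine ⟨hsub.good hg, hN, ?_, ?_⟩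
    · intro i j hij hj
      rcases Nat.lt_or_ge j (k - 3) with h | h
      · have := hi.mono (i + 3) (j + 3) (by omega) (by omega)
        rw [hfirst i (by omega), hfirst j h] at this
        split_ifs at this <;> omega
      · obtain rfl : j = k - 3 := by omega
        have := hinc (i + 3) (by omega)
        rw [hfirst i (by omega), hlast] at this
        split_ifs at this <;> omega
    · intro i hik
      rcases Nat.lt_or_ge i (k - 3) with h | h
      · have := hi.mono 2 (i + 3) (by omega) (by omega)
        rw [hfirst i h] at this
        split_ifs at this <;> omega
      · obtain rfl : i = k - 3 := by omega
        have := hinc 2 (by omega)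
        rw [hlast] at this
        split_ifs at this <;> omega
  · rintro ⟨hg, hi⟩
    have hbig : ∀ i < k, 3 ≤ i → k + 2 ≤ v i := by
      intro i hik h
      have h3 := hfirst (i - 3) (by omega)
      have := hi.ge (i - 3) (by omega)
      rw [show i - 3 + 3 = i by omega] at h3
      rw [h3]
      split_ifs <;> omega
    have hbig_last : k + 2 ≤ v (k + 1) := by
      have := hi.ge (k - 3) (by omega)
      rw [hlast]
      split_ifs <;> omega
    have hsmall : ∀ i < 3, v i = k - 1 + i := by
      intro i hi3
      obtain rfl | rfl | rfl : i = 0 ∨ i = 1 ∨ i = 2 := by omega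
      all_goals omega
    have hinc : IncStart k (N + 4) k v := by
      refine ⟨by omega, ?_, ?_⟩
      · intro i j hij hj
        rcases Nat.lt_or_ge i 3 with h | h
        · have := hsmall i h
          rcases Nat.lt_or_ge j 3 with h' | h'
          · have := hsmall j h'
            omega
          · have := hbig j hj h'
            omega
        · obtain ⟨i, rfl⟩ : ∃ x, i = x + 3 := ⟨i - 3, by omega⟩
          obtain ⟨j, rfl⟩ : ∃ x, j = x + 3 := ⟨j - 3, by omega⟩
          have := hi.mono i j (by omega) (by omega)
          rw [hfirst i (by omega), hfirst j (by omega)]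
          split_ifs <;> omega
      · intro i hik
        rcases Nat.lt_or_ge i 3 with h | h
        · have := hsmall i h
          omega
        · have := hbig i hik h
          omega
    have hmem : ∀ p < N + 4, 3 ≤ p → p ≠ k →
        ∃ x < N, (if x < k - 3 then x + 3 else x + 4) = p := by
      intro p hp hp3 hpk
      rcases Nat.lt_or_ge p k with h | h
      · exact ⟨p - 3, by omega, by split_ifs <;> omega⟩
      · exact ⟨p - 4, by omega, by split_ifs <;> omega⟩
    refine ⟨⟨⟨?_, ?_⟩, hinc⟩, by omega⟩
    · rintro ⟨p, q, r, hpq, hqr, hr, hrq, hqp⟩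
      have hpk : p ≠ k := by rintro rfl; omega
      have hqk : q ≠ k := by rintro rfl; omega
      have hqge : k ≤ q := by
        by_contra hlt
        have := hinc.mono p q hpq (by omega)
        omega
      have hq := hmem q (by omega) (by omega) hqk
      have hr := hmem r hr (by omega) (by omega)
      rcases Nat.lt_or_ge p 3 with h | h
      · have hvp := hsmall p h
        have hqk1 : q ≠ k + 1 := by rintro rfl; omega
        exact hg.desc (hsub.hasDesc (p := k + 1) (by omega) hqr hrq (by omega)
          (hmem (k + 1) (by omega) (by omega) (by omega)) hq hr)
      · exact hg.desc (hsub.hasDesc hpq hqr hrq hqp (hmem p (by omega) h hpk) hq hr)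
    · intro b s G
      obtain ⟨hb, hs, hb1, hlt, hne, hne'⟩ := G.bounds hk (by omega) hv h0 h1
      have hbk : ∀ i < k, b i ≠ k := by
        intro i hik e
        have := (hb i hik).2.1
        rw [e] at this
        omega
      have hb1' : 3 ≤ b 1 := by
        by_contra hlt
        have := hsmall (b 1) (by omega)
        omega
      have hb0 : 3 ≤ b 0 := by
        by_contra hb0
        have hvb0 := hsmall (b 0) (by omega)
        have hs0 : v (s 0) = 0 := by
          have := hs (k - 2) (by omega)
          omega
        have hs0' : s 0 = k := hv.inj _ (G.s_lt 0 (by omega)) _ (by omega) (by omega)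
        have h3 := G.pos (k - 2) 0 (by omega) (by omega) (by omega)
        have h5 := add_sub_le_of_strictMono_below G.b_mono (show 1 ≤ k - 2 by omega) (by omega)
        omega
      have hs0 : k + 1 < s 0 := by
        have h3 := G.pos (k - 2) 0 (by omega) (by omega) (by omega)
        have h4 := hbk (k - 2) (by omega)
        have h5 := hb (k - 2) (by omega)
        omega
      obtain ⟨b', s', G'⟩ := hsub.isGon G
        (fun i hik => hmem _ (hb i hik).2.2 (by have := hb i hik; omega) (hbk i hik))
        (fun j hj => by
          have := hs j hj
          exact hmem _ this.2.2.2 (by omega) (by omega))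
      exact hg.gon b' s' G'

/-- Inserting the entry `k-1` at the front. -/
theorem good_iff_insert_front {k N : ℕ} {u v : ℕ → ℕ} (hk : 3 ≤ k)
    (hu : IsPermBelow N u) (hv : IsPermBelow (N + 1) v) (h0 : v 0 = k - 1)
    (he : ∀ i < N, v (i + 1) = if u i < k - 1 then u i else u i + 1) :
    (GoodBelow k (N + 1) v ∧ IncStart k (N + 1) k v) ∧ k < N + 1 ∧ v k ≠ 0 ↔
      GoodBelow k N u ∧ IncStart k N k u := by
  have hsub : IsSubpattern N (N + 1) u v (fun i => i + 1) := by
    refine IsSubpattern.of_eq (g := fun x => if x < k - 1 then x else x + 1) ?_ ?_ ?_ he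
    · intro i hi; omega
    · intro i j hij; omega
    · intro i j hij; split_ifs <;> omega
  constructor
  · rintro ⟨⟨hg, hi⟩, hkN, hvk⟩
    have hinc : ∀ i < k, v i < v k := by
      obtain ⟨p, hp, hp0⟩ := hv.surj 0 (by omega)
      have hpk : k < p := by
        by_contra hlt
        rcases Nat.lt_or_ge p k with h | h
        · have := hi.ge p h
          omega
        · obtain rfl : p = k := by omega
          omega
      intro i hik
      have hne' : v k ≠ v i := fun e => by
        have := hv.inj k (by omega) i (by omega) (by omega)
        omega
      by_contra hlt
      have := hg.not_desc (p := i) (q := k) (r := p) (by omega) hpk hp (by omega)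
      omega
    have hmono : ∀ i j, i < j → j < k + 1 → v i < v j := by
      intro i j hij hj
      rcases Nat.lt_or_ge j k with h | h
      · exact hi.mono i j hij h
      · obtain rfl : j = k := by omega
        exact hinc i hij
    refine ⟨hsub.good hg, by omega, ?_, ?_⟩
    · intro i j hij hj
      have := hmono (i + 1) (j + 1) (by omega) (by omega)
      rw [he i (by omega), he j (by omega)] at this
      split_ifs at this <;> omega
    · intro i hik
      have := hmono 0 (i + 1) (by omega) (by omega)
      rw [he i (by omega)] at this
      split_ifs at this <;> omega
  · rintro ⟨hg, hi⟩
    have hkN := hi.le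
    obtain ⟨hu0, hu1⟩ := first_two_entries hk hu hg hi
    have hshift : ∀ i < k, v (i + 1) = u i + 1 := by
      intro i hik
      have := hi.ge i hik
      rw [he i (by omega), if_neg (by omega)]
    have h1 : v 1 = k := by
      have := hshift 0 (by omega)
      simp only [Nat.zero_add] at this
      omega
    have h2 : v 2 = k + 1 := by
      have := hshift 1 (by omega)
      simp only [Nat.reduceAdd] at this
      omega
    have hmono : ∀ i j, i < j → j < k + 1 → v i < v j := by
      intro i j hij hj
      obtain ⟨j, rfl⟩ : ∃ x, j = x + 1 := ⟨j - 1, by omega⟩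
      have hj' := hi.ge j (by omega)
      rw [hshift j (by omega)]
      rcases Nat.eq_zero_or_pos i with rfl | h
      · omega
      · obtain ⟨i, rfl⟩ : ∃ x, i = x + 1 := ⟨i - 1, by omega⟩
        have := hi.mono i j (by omega) (by omega)
        rw [hshift i (by omega)]
        omega
    have hinc : IncStart k (N + 1) k v := by
      refine ⟨by omega, fun i j hij hj => hmono i j hij (by omega), ?_⟩
      intro i hik
      rcases Nat.eq_zero_or_pos i with rfl | h
      · omega
      · have := hmono 0 i h (by omega)
        omega
    have hmem : ∀ p < N + 1, 1 ≤ p → ∃ x < N, x + 1 = p :=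
      fun p hp hp1 => ⟨p - 1, by omega, by omega⟩
    refine ⟨⟨⟨?_, ?_⟩, hinc⟩, by omega, ?_⟩
    · rintro ⟨p, q, r, hpq, hqr, hr, hrq, hqp⟩
      have hq := hmem q (by omega) (by omega)
      have hr := hmem r hr (by omega)
      rcases Nat.eq_zero_or_pos p with rfl | h
      · have hq1 : q ≠ 1 := by rintro rfl; omega
        exact hg.desc (hsub.hasDesc (p := 1) (by omega) hqr hrq (by omega)
          (hmem 1 (by omega) le_rfl) hq hr)
      · exact hg.desc (hsub.hasDesc hpq hqr hrq hqp (hmem p (by omega) h) hq hr)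
    · intro b s G
      obtain ⟨hb, hs, hb1, hlt, hne, hne'⟩ := G.bounds hk (by omega) hv h0 h1
      have hb1' : 3 ≤ b 1 := by
        by_contra hlt
        obtain h | h | h : b 1 = 0 ∨ b 1 = 1 ∨ b 1 = 2 := by omega
        all_goals rw [h] at hb1; omega
      have hs_mem : ∀ j < k, ∃ x < N, x + 1 = s j := fun j hj => by
        have := hs j hj
        exact hmem _ this.2.2.2 (by omega)
      rcases Nat.eq_zero_or_pos (b 0) with hb0 | hb0
      · have hb_ge : ∀ i, 0 < i → i < k → 3 ≤ b i ∧ k + 2 ≤ v (b i) := by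
          intro i hi0 hik
          rcases Nat.lt_or_ge 1 i with h | h
          · have := G.b_mono 1 i h hik
            have := G.vb_mono 1 i h hik
            omega
          · obtain rfl : i = 1 := by omega
            exact ⟨hb1', hb1⟩
        have G₁ : IsGon k (N + 1) v (fun i => if i = 0 then 1 else b i) s := by
          refine ⟨?_, G.s_lt, ?_, G.s_mono, ?_, G.vs_mono, ?_, ?_⟩
          · intro i hik
            have := G.b_lt i hik
            split_ifs <;> omega
          · intro i j hij hj
            have := hb_ge j (by omega) hj
            have := G.b_mono i j hij hj
            split_ifs <;> omega
          · intro i j hij hj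
            have := hb_ge j (by omega) hj
            have := G.vb_mono i j hij hj
            split_ifs <;> omega
          · intro i j hik hj hij
            have := G.pos i j hik hj hij
            have := hs j hj
            split_ifs <;> omega
          · intro i j hik hj hij
            have := G.val i j hik hj hij
            split_ifs with h
            · rw [h, hb0] at this
              omega
            · exact this
        obtain ⟨b', s', G'⟩ := hsub.isGon G₁
          (fun i hik => hmem _ (G₁.b_lt i hik) (by
            have := hb_ge i
            split_ifs <;> omega)) hs_mem
        exact hg.gon b' s' G'
      · obtain ⟨b', s', G'⟩ := hsub.isGon G
          (fun i hik => hmem _ (hb i hik).2.2 (by have := hb i hik; omega)) hs_mem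
        exact hg.gon b' s' G'
    · have := hmono 0 k (by omega) (by omega)
      omega

theorem card_subtype_eq_add {α : Type*} [Finite α] (P Q : α → Prop) :
    Nat.card {x // P x} = Nat.card {x // P x ∧ Q x} + Nat.card {x // P x ∧ ¬ Q x} := by
  classical
  have := Fintype.ofFinite α
  simp only [Nat.card_eq_fintype_card, Fintype.card_subtype]
  rw [← Finset.filter_filter, ← Finset.filter_filter, Finset.card_filter_add_card_filter_not]

/-- The permutations counted by `A_k(n, k)` whose initial run is followed by `1, 2`. -/
theorem card_followed_by_zero_one {k N : ℕ} (hk : 3 ≤ k) (hN : k - 2 ≤ N) :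
    Nat.card {π : Equiv.Perm (Fin (N + 4)) //
      (GoodBelow k (N + 4) (natVal π) ∧ IncStart k (N + 4) k (natVal π)) ∧
        natVal π k = 0 ∧ natVal π (k + 1) = 1} = Aseq k (k - 2) N (k - 2) := by
  rw [Aseq_eq_card hk (by omega)]
  have hmem : ∀ p < N + 4, (∀ i < N, (if i < k - 2 then i + 2 else i + 4) ≠ p) →
      p = 0 ∨ p = 1 ∨ p = k ∨ p = k + 1 := by
    intro p hp h
    by_contra hne
    rcases Nat.lt_or_ge p k with hpk | hpk
    · exact h (p - 2) (by omega) (by split_ifs <;> omega)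
    · exact h (p - 4) (by omega) (by split_ifs <;> omega)
  refine card_perm_eq_of_prescribed (fun i => if i < k - 2 then i + 2 else i + 4)
    (fun p => if p = 0 then k - 1 else if p = 1 then k else if p = k then 0
      else if p = k + 1 then 1 else if p = k - 1 then k + 1 else p) ?_ ?_ ?_ ?_
    (fun v => (GoodBelow k (N + 4) v ∧ IncStart k (N + 4) k v) ∧ v k = 0 ∧ v (k + 1) = 1)
    (fun u => GoodBelow k N u ∧ IncStart (k - 2) N (k - 2) u) ?_ ?_
  · intro i hi; split_ifs <;> omega
  · intro i hi j hj; split_ifs <;> omega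
  · intro p hp; split_ifs <;> omega
  · intro p hp q hq h; split_ifs at h <;> omega
  · rintro π ⟨⟨hg, hi⟩, hk0, hk1⟩ p hp hne
    obtain ⟨h0, h1⟩ := first_two_entries hk (isPermBelow_natVal π) hg hi
    obtain rfl | rfl | rfl | rfl := hmem p hp hne <;> (repeat' split) <;> omega
  · intro π σ heq hfix
    have hk0 : natVal π k = 0 := by
      rw [hfix k (by omega) (by intro i _; split_ifs <;> omega)]; (repeat' split) <;> omega
    have hk1 : natVal π (k + 1) = 1 := by
      rw [hfix (k + 1) (by omega) (by intro i _; split_ifs <;> omega)]; (repeat' split) <;> omega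
    rw [← good_iff_insert_zero_one hk hN (isPermBelow_natVal π) ?_ ?_ hk0 hk1 ?_]
    · simp [hk0, hk1]
    · rw [hfix 0 (by omega) (by intro i _; split_ifs <;> omega)]; simp
    · rw [hfix 1 (by omega) (by intro i _; split_ifs <;> omega)]; simp
    · intro i hi
      rw [heq i hi]
      generalize natVal σ i = x
      (repeat' split) <;> omega

/-- The permutations counted by `A_k(n, k)` whose initial run is followed by `1` but not by
`1, 2`. -/
theorem card_followed_by_zero_ne_one {k N : ℕ} (hk : 3 ≤ k) (hN : k - 2 ≤ N) :
    Nat.card {π : Equiv.Perm (Fin (N + 4)) //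
      (GoodBelow k (N + 4) (natVal π) ∧ IncStart k (N + 4) k (natVal π)) ∧
        natVal π k = 0 ∧ natVal π (k + 1) ≠ 1} = Aseq k (k - 1) N (k - 2) := by
  rw [Aseq_eq_card hk (by omega)]
  have hmem : ∀ p < N + 4, (∀ i < N, (if i < k - 3 then i + 3 else i + 4) ≠ p) →
      p = 0 ∨ p = 1 ∨ p = 2 ∨ p = k := by
    intro p hp h
    by_contra hne
    rcases Nat.lt_or_ge p k with hpk | hpk
    · exact h (p - 3) (by omega) (by split_ifs <;> omega)
    · exact h (p - 4) (by omega) (by split_ifs <;> omega)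
  refine card_perm_eq_of_prescribed (fun i => if i < k - 3 then i + 3 else i + 4)
    (fun p => if p < 3 then p + k - 1 else if p < k then p - 2 else if p = k then 0
      else if p = k + 1 then k - 2 else p) ?_ ?_ ?_ ?_
    (fun v => (GoodBelow k (N + 4) v ∧ IncStart k (N + 4) k v) ∧ v k = 0 ∧ v (k + 1) ≠ 1)
    (fun u => GoodBelow k N u ∧ IncStart (k - 1) N (k - 2) u) ?_ ?_
  · intro i hi; split_ifs <;> omega
  · intro i hi j hj; split_ifs <;> omega
  · intro p hp; split_ifs <;> omega
  · intro p hp q hq; split_ifs <;> omega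
  · rintro π ⟨⟨hg, hi⟩, hk0, hk1⟩ p hp hne
    obtain ⟨h0, h1⟩ := first_two_entries hk (isPermBelow_natVal π) hg hi
    have h2 : natVal π 2 = k + 1 := by
      by_contra h2
      exact hk1 (next_entries_of_third_ne hk (by omega) (isPermBelow_natVal π) hg hi h2).2
    obtain rfl | rfl | rfl | rfl := hmem p hp hne <;> split_ifs <;> omega
  · intro π σ heq hfix
    have hk0 : natVal π k = 0 := by
      rw [hfix k (by omega) (by intro i _; split_ifs <;> omega)]; split_ifs <;> omega
    rw [← good_iff_insert_zero hk hN (isPermBelow_natVal π) ?_ ?_ ?_ hk0 ?_]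
    · simp [hk0]
    · rw [hfix 0 (by omega) (by intro i _; split_ifs <;> omega)]; simp
    · rw [hfix 1 (by omega) (by intro i _; split_ifs <;> omega)]; simp
    · rw [hfix 2 (by omega) (by intro i _; split_ifs <;> omega)]; simp; omega
    · intro i hi
      rw [heq i hi]
      generalize natVal σ i = x
      split_ifs <;> omega

/-- The permutations counted by `A_k(n, k)` whose initial run is not followed by `1`. -/
theorem card_not_followed_by_zero {k N : ℕ} (hk : 3 ≤ k) (hN : k < N) :
    Nat.card {π : Equiv.Perm (Fin (N + 1)) //
      (GoodBelow k (N + 1) (natVal π) ∧ IncStart k (N + 1) k (natVal π)) ∧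
        natVal π k ≠ 0} = Aseq k k N k := by
  rw [Aseq_eq_card hk (by omega)]
  refine card_perm_eq_of_prescribed (fun i => i + 1)
    (fun p => if p = 0 then k - 1 else if p < k then p - 1 else p) ?_ ?_ ?_ ?_
    (fun v => (GoodBelow k (N + 1) v ∧ IncStart k (N + 1) k v) ∧ v k ≠ 0)
    (fun u => GoodBelow k N u ∧ IncStart k N k u) ?_ ?_
  · intro i hi; omega
  · intro i hi j hj; omega
  · intro p hp; split_ifs <;> omega
  · intro p hp q hq; split_ifs <;> omega
  · rintro π ⟨⟨hg, hi⟩, -⟩ p hp hne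
    obtain ⟨h0, h1⟩ := first_two_entries hk (isPermBelow_natVal π) hg hi
    obtain rfl : p = 0 := by
      by_contra h
      exact hne (p - 1) (by omega) (by omega)
    simpa using h0
  · intro π σ heq hfix
    rw [← good_iff_insert_front hk (isPermBelow_natVal σ) (isPermBelow_natVal π) ?_ ?_]
    · have : k < N + 1 := by omega
      simp [this]
    · rw [hfix 0 (by omega) (by simp)]; simp
    · intro i hi
      rw [heq i hi]
      generalize natVal σ i = x
      (repeat' split) <;> omega

theorem Aseq_eq_zero {k d n m : ℕ} (h : n + 1 - d < m) : Aseq k d n m = 0 := by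
  unfold Aseq
  rw [Finset.powersetCard_eq_empty.2 (by simpa using h), Finset.sum_empty]

/-- For `k ≥ 3` and `n ≥ k−1`:
`A_k(n, k) − A_k(n−1, k) = A_{k−2}(n−4, k−2) + A_{k−1}(n−4, k−2)`. -/
theorem Aseq_diff (k n : ℕ) (hk : 3 ≤ k) (hn : k - 1 ≤ n) :
    (Aseq k k n k : ℤ) - (Aseq k k (n-1) k : ℤ) =
      (Aseq k (k-2) (n-4) (k-2) : ℤ) + (Aseq k (k-1) (n-4) (k-2) : ℤ) := by
  rcases Nat.lt_or_ge n (2 * k - 1) with h | h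
  · rw [Aseq_eq_zero (show n + 1 - k < k by omega),
      Aseq_eq_zero (show n - 1 + 1 - k < k by omega),
      Aseq_eq_zero (show n - 4 + 1 - (k - 2) < k - 2 by omega),
      Aseq_eq_zero (show n - 4 + 1 - (k - 1) < k - 2 by omega)]
    simp
  · obtain ⟨N, rfl⟩ : ∃ N, n = N + 4 := ⟨n - 4, by omega⟩
    have key : Aseq k k (N + 4) k =
        Aseq k (k - 2) N (k - 2) + Aseq k (k - 1) N (k - 2) + Aseq k k (N + 3) k := by
      rw [Aseq_eq_card (n := N + 4) hk (by omega),
        card_subtype_eq_add _ (fun π : Equiv.Perm (Fin (N + 4)) => natVal π k = 0),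
        card_subtype_eq_add (fun π : Equiv.Perm (Fin (N + 4)) => (_ ∧ _) ∧ _)
          (fun π => natVal π (k + 1) = 1)]
      simp only [and_assoc (b := natVal _ k = 0)]
      rw [card_followed_by_zero_one hk (by omega), card_followed_by_zero_ne_one hk (by omega),
        card_not_followed_by_zero hk (by omega)]
    rw [key, show N + 4 - 1 = N + 3 by omega, show N + 4 - 4 = N by omega]
    push_cast
    ring
end

section
/- Let k ≥ 3 and 1 ≤ d ≤ k−2. Then for every n ≥ k, Σ_{j=0}^{k−1} (−1)^j binom(k−1−j, j) x_{k,d}^1(n−j) = binom(n−d−1, k−d−2), and for every n with 0 ≤ n ≤ k−1, x_{k,d}^1(n) = binom(2n, n)/(n+1), the n-th Catalan number. (Here binom(a,b) denotes the binomial coefficient, equal to 0 when b > a.) -/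
/-- The length-`k` pattern `(d+1)(d+2)⋯(k−1) 1 2 ⋯ j k (j+1)(j+2)⋯d` of `X_{k,d}^1`. -/
def X1pat (k d j : ℕ) : List ℕ :=
  List.range' (d+1) (k-1-d) ++ List.range' 1 j ++ [k] ++ List.range' (j+1) (d-j)

/-- `x_{k,d}^1(n)`: the number of permutations of `{1,…,n}` avoiding every pattern in
`X_{k,d}^1`, i.e. `321` and the patterns `X1pat k d j` for `j = 0,1,…,d`. -/
noncomputable def x1 (k d n : ℕ) : ℕ :=
  Nat.card {π : Equiv.Perm (Fin n) //
    AvoidsPattern π [3,2,1] ∧ ∀ j ≤ d, AvoidsPattern π (X1pat k d j)}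


/-- `π` has no decreasing subsequence of length three. -/
def Avoids321 {n : ℕ} (π : Equiv.Perm (Fin n)) : Prop :=
  ∀ i j l : Fin n, i < j → j < l → π l < π j → ¬ π j < π i

/-- `e` positions all of which lie to the left of, and have larger values than, `d` other
positions. -/
def HasBlocks (e d : ℕ) {n : ℕ} (π : Equiv.Perm (Fin n)) : Prop :=
  ∃ A B : Finset (Fin n), A.card = e ∧ B.card = d ∧ ∀ a ∈ A, ∀ b ∈ B, a < b ∧ π b < π a

/-- Blocks as in `HasBlocks`, with a further position to the right of the first block and of
larger value. -/
def HasCappedBlocks (e d : ℕ) {n : ℕ} (π : Equiv.Perm (Fin n)) : Prop :=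
  ∃ (A B : Finset (Fin n)) (m : Fin n), A.card = e ∧ B.card = d ∧
    (∀ a ∈ A, ∀ b ∈ B, a < b ∧ π b < π a) ∧ ∀ a ∈ A, a < m ∧ π a < π m

theorem avoidsPattern_321_iff {n : ℕ} (π : Equiv.Perm (Fin n)) :
    AvoidsPattern π [3, 2, 1] ↔ Avoids321 π := by
  unfold AvoidsPattern ContainsPattern Avoids321
  constructor
  · intro h i j l hij hjl h1 h2
    apply h
    refine ⟨![i, j, l], ?_, ?_⟩
    · intro a b hab
      fin_cases a <;> fin_cases b <;> simp_all
      exact hij.trans hjl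
    · intro a b
      have h3 := h1.trans h2
      fin_cases a <;> fin_cases b <;> simp [h1, h2, h3, h1.le, h2.le, h3.le]
  · rintro h ⟨f, hf, hw⟩
    refine h (f ⟨0, by simp⟩) (f ⟨1, by simp⟩) (f ⟨2, by simp⟩) (hf (by simp)) (hf (by simp))
      ((hw ⟨2, by simp⟩ ⟨1, by simp⟩).1 (by simp)) ((hw ⟨1, by simp⟩ ⟨0, by simp⟩).1 (by simp))

theorem length_X1pat {e d j : ℕ} (hj : j ≤ d) : (X1pat (e + d + 1) d j).length = e + d + 1 := by
  simp [X1pat]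
  omega

theorem X1pat_getElem {e d j : ℕ} (x : ℕ) (hx : x < (X1pat (e + d + 1) d j).length) :
    (X1pat (e + d + 1) d j)[x] =
      if x < e then d + 1 + x else if x < e + j then x - e + 1
      else if x = e + j then e + d + 1 else x - e := by
  have he : e + d + 1 - 1 - d = e := by omega
  simp only [X1pat, he, List.getElem_append, List.length_append, List.length_range',
    List.getElem_range', List.length_singleton]
  split_ifs <;> simp_all <;> omega

theorem capped_of_contains {e d j n : ℕ} (hj : j ≤ d) {π : Equiv.Perm (Fin n)}
    (h : ContainsPattern π (X1pat (e + d + 1) d j)) : HasCappedBlocks e d π := by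
  obtain ⟨f, hf, hw⟩ := h
  have hl := length_X1pat (e := e) hj
  let g : ℕ → Fin (X1pat (e + d + 1) d j).length := fun x => ⟨min x (e + d), by omega⟩
  have hg : ∀ x y, x < y → y ≤ e + d → f (g x) < f (g y) := fun x y hxy hy =>
    hf (by simp only [g, Fin.mk_lt_mk]; omega)
  have hv : ∀ x y, x ≤ e + d → y ≤ e + d →
      (if x < e then d + 1 + x else if x < e + j then x - e + 1
        else if x = e + j then e + d + 1 else x - e) <
      (if y < e then d + 1 + y else if y < e + j then y - e + 1
        else if y = e + j then e + d + 1 else y - e) → π (f (g x)) < π (f (g y)) := by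
    intro x y hx hy hxy
    refine (hw (g x) (g y)).1 ?_
    simp only [List.get_eq_getElem, X1pat_getElem, g, min_eq_left hx, min_eq_left hy]
    exact hxy
  have hinj : ∀ x y, x ≤ e + d → y ≤ e + d → f (g x) = f (g y) → x = y := by
    intro x y hx hy hxy
    have := hf.injective hxy
    simp only [g, Fin.mk.injEq] at this
    omega
  refine ⟨(Finset.range e).image (f ∘ g),
    ((Finset.Ico e (e + d + 1)).erase (e + j)).image (f ∘ g), f (g (e + j)), ?_, ?_, ?_, ?_⟩
  · rw [Finset.card_image_of_injOn, Finset.card_range]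
    intro x hx y hy hxy
    simp only [Finset.coe_range, Set.mem_Iio] at hx hy
    exact hinj x y (by omega) (by omega) hxy
  · rw [Finset.card_image_of_injOn, Finset.card_erase_of_mem, Nat.card_Ico]
    · omega
    · simp; omega
    intro x hx y hy hxy
    simp only [Finset.coe_erase, Finset.coe_Ico, Set.mem_sdiff, Set.mem_Ico] at hx hy
    exact hinj x y (by omega) (by omega) hxy
  · simp only [Finset.mem_image, Finset.mem_range, Finset.mem_erase, Finset.mem_Ico]
    rintro _ ⟨x, hx, rfl⟩ _ ⟨y, hy, rfl⟩
    refine ⟨hg _ _ (by omega) (by omega), hv _ _ (by omega) (by omega) ?_⟩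
    split_ifs <;> omega
  · simp only [Finset.mem_image, Finset.mem_range]
    rintro _ ⟨x, hx, rfl⟩
    refine ⟨hg _ _ (by omega) (by omega), hv _ _ (by omega) (by omega) ?_⟩
    split_ifs <;> omega

theorem contains_of_capped {e d n : ℕ} (he : 1 ≤ e) (hd : 1 ≤ d) {π : Equiv.Perm (Fin n)}
    (hπ : Avoids321 π) (h : HasCappedBlocks e d π) :
    ∃ j ≤ d, ContainsPattern π (X1pat (e + d + 1) d j) := by
  obtain ⟨A, B, m, hA, hB, hAB, hm⟩ := h
  obtain ⟨fA, monoA, memA⟩ : ∃ f : Fin e → Fin n, StrictMono f ∧ ∀ x, f x ∈ A :=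
    ⟨A.orderEmbOfFin hA, (A.orderEmbOfFin hA).strictMono, A.orderEmbOfFin_mem hA⟩
  obtain ⟨fB, monoB, memB⟩ : ∃ f : Fin d → Fin n, StrictMono f ∧ ∀ x, f x ∈ B :=
    ⟨B.orderEmbOfFin hB, (B.orderEmbOfFin hB).strictMono, B.orderEmbOfFin_mem hB⟩
  have a0 := memA ⟨0, he⟩
  have b0 := memB ⟨0, hd⟩
  have incA : ∀ x y, x < y → fA x < fA y ∧ π (fA x) < π (fA y) := by
    intro x y hxy
    have hlt : fA x < fA y := monoA hxy
    refine ⟨hlt, lt_of_le_of_ne (not_lt.1 fun hc => ?_) fun hc => hlt.ne (π.injective hc)⟩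
    exact hπ _ _ _ hlt (hAB _ (memA y) _ b0).1 (hAB _ (memA y) _ b0).2 hc
  have incB : ∀ x y, x < y → fB x < fB y ∧ π (fB x) < π (fB y) := by
    intro x y hxy
    have hlt : fB x < fB y := monoB hxy
    refine ⟨hlt, lt_of_le_of_ne (not_lt.1 fun hc => ?_) fun hc => hlt.ne (π.injective hc)⟩
    exact hπ _ _ _ (hAB _ a0 _ (memB x)).1 hlt hc (hAB _ a0 _ (memB x)).2
  have hBm : ∀ x, π (fB x) < π m := fun x => (hAB _ a0 _ (memB x)).2.trans (hm _ a0).2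
  have hne : ∀ x, fB x ≠ m := fun x hx => (hBm x).ne (by rw [hx])
  obtain ⟨j, hj, hlo, hhi⟩ : ∃ j ≤ d, (∀ x : Fin d, x.1 < j → fB x < m) ∧
      ∀ x : Fin d, j ≤ x.1 → m < fB x := by
    have key : ∃ j, j = d ∨ ∃ h : j < d, m < fB ⟨j, h⟩ := ⟨d, Or.inl rfl⟩
    classical
    refine ⟨Nat.find key, ?_, ?_, ?_⟩
    · rcases Nat.find_spec key with h | ⟨h, -⟩ <;> omega
    · intro x hx
      have := Nat.find_min key hx
      push Not at this
      exact lt_of_le_of_ne (this.2 x.2) (hne x)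
    · intro x hx
      rcases Nat.find_spec key with h | ⟨h, hlt⟩
      · omega
      · exact hlt.trans_le (monoB.monotone (Fin.mk_le_of_le_val hx))
  refine ⟨j, hj, ?_⟩
  have hl := length_X1pat (e := e) hj
  let F : ℕ → Fin n := fun x => if hx : x < e then fA ⟨x, hx⟩ else
    if hx' : x < e + j then fB ⟨x - e, by omega⟩ else
    if hx'' : x ≠ e + j ∧ x < e + d + 1 then fB ⟨x - e - 1, by omega⟩ else m
  have hF : ∀ x y, x < y → y < e + d + 1 → F x < F y := by
    intro x y hxy hy
    simp only [F]
    split_ifs <;> first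
      | omega
      | exact (incA _ _ (Fin.mk_lt_mk.2 (by omega))).1
      | exact (incB _ _ (Fin.mk_lt_mk.2 (by omega))).1
      | exact (hAB _ (memA _) _ (memB _)).1
      | exact (hm _ (memA _)).1
      | exact hlo _ (by simp only; omega)
      | exact hhi _ (by simp only; omega)
  have hv : ∀ x y, x < e + d + 1 → y < e + d + 1 →
      (if x < e then d + 1 + x else if x < e + j then x - e + 1
        else if x = e + j then e + d + 1 else x - e) <
      (if y < e then d + 1 + y else if y < e + j then y - e + 1
        else if y = e + j then e + d + 1 else y - e) → π (F x) < π (F y) := by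
    intro x y hx hy hxy
    simp only [F]
    split_ifs at hxy ⊢ <;> first
      | omega
      | exact (incA _ _ (Fin.mk_lt_mk.2 (by omega))).2
      | exact (incB _ _ (Fin.mk_lt_mk.2 (by omega))).2
      | exact (hAB _ (memA _) _ (memB _)).2
      | exact (hm _ (memA _)).2
      | exact hBm _
  refine ⟨fun x => F x, fun x y hxy => hF _ _ hxy (by omega), fun a b => ?_⟩
  simp only [List.get_eq_getElem, X1pat_getElem]
  refine ⟨hv _ _ (by omega) (by omega), fun hlt => ?_⟩
  by_contra hc
  rcases (not_lt.1 hc).lt_or_eq with h | h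
  · exact absurd (hv _ _ (by omega) (by omega) h) (not_lt.2 hlt.le)
  · have hab : a.1 = b.1 := by
      have := a.2
      have := b.2
      split_ifs at h <;> omega
    rw [hab] at hlt
    exact lt_irrefl _ hlt

theorem avoids_X1_iff {e d n : ℕ} (he : 1 ≤ e) (hd : 1 ≤ d) (π : Equiv.Perm (Fin n)) :
    (AvoidsPattern π [3, 2, 1] ∧ ∀ j ≤ d, AvoidsPattern π (X1pat (e + d + 1) d j)) ↔
      Avoids321 π ∧ ¬ HasCappedBlocks e d π := by
  rw [avoidsPattern_321_iff]
  refine and_congr_right fun hπ => ⟨fun h hc => ?_, fun h j hj hc => h (capped_of_contains hj hc)⟩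
  obtain ⟨j, hj, hc⟩ := contains_of_capped he hd hπ hc
  exact h j hj hc

/-- Insert a new largest value at position `p`. -/
def insertMax {n : ℕ} (p : Fin (n + 1)) (π : Equiv.Perm (Fin n)) : Equiv.Perm (Fin (n + 1)) :=
  (finSuccEquiv' p).trans ((Equiv.optionCongr π).trans (finSuccEquiv' (Fin.last n)).symm)

@[simp]
theorem insertMax_self {n : ℕ} (p : Fin (n + 1)) (π : Equiv.Perm (Fin n)) :
    insertMax p π p = Fin.last n := by
  simp [insertMax]

@[simp]
theorem insertMax_succAbove {n : ℕ} (p : Fin (n + 1)) (π : Equiv.Perm (Fin n)) (j : Fin n) :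
    insertMax p π (p.succAbove j) = (π j).castSucc := by
  simp [insertMax]

/-- Every permutation of `n + 1` points arises uniquely by inserting a largest value. -/
noncomputable def insertMaxEquiv (n : ℕ) :
    Fin (n + 1) × Equiv.Perm (Fin n) ≃ Equiv.Perm (Fin (n + 1)) :=
  Equiv.ofBijective (fun x => insertMax x.1 x.2) <| by
    rw [Fintype.bijective_iff_injective_and_card]
    constructor
    · rintro ⟨p, π⟩ ⟨p', π'⟩ h
      simp only at h
      have hp : p = p' := by
        apply (insertMax p π).injective
        rw [insertMax_self, h, insertMax_self]
      subst hp
      have : π = π' := by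
        ext j
        have := congrArg (fun σ => ((σ (p.succAbove j)).1)) h
        simpa using this
      rw [this]
    · simp [Fintype.card_perm, Nat.factorial_succ]

theorem insertMaxEquiv_apply {n : ℕ} (p : Fin (n + 1)) (π : Equiv.Perm (Fin n)) :
    insertMaxEquiv n (p, π) = insertMax p π := rfl

theorem lt_succAbove_iff {n : ℕ} (p : Fin (n + 1)) (j : Fin n) :
    p < p.succAbove j ↔ p ≤ j.castSucc := Fin.lt_succAbove_iff_le_castSucc p j

theorem succAbove_lt_iff {n : ℕ} (p : Fin (n + 1)) (j : Fin n) :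
    p.succAbove j < p ↔ j.castSucc < p := Fin.succAbove_lt_iff_castSucc_lt p j

theorem avoids_insertMax_iff {n : ℕ} (p : Fin (n + 1)) (π : Equiv.Perm (Fin n)) :
    Avoids321 (insertMax p π) ↔
      Avoids321 π ∧ ∀ i j : Fin n, p ≤ i.castSucc → i < j → π i < π j := by
  constructor
  · intro h
    refine ⟨fun i j l hij hjl h1 h2 => ?_, fun i j hp hij => ?_⟩
    · refine h (p.succAbove i) (p.succAbove j) (p.succAbove l) ?_ ?_ ?_ ?_ <;> simpa
    · refine lt_of_le_of_ne (not_lt.1 fun hc => ?_) fun hc => hij.ne (π.injective hc)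
      refine h p (p.succAbove i) (p.succAbove j) ((lt_succAbove_iff _ _).2 hp) (by simpa)
        (by simpa) (by simp [Fin.castSucc_lt_last])
  · rintro ⟨h, hinc⟩ i j l hij hjl h1 h2
    rcases p.eq_self_or_eq_succAbove j with rfl | ⟨j, rfl⟩
    · rw [insertMax_self] at h2
      exact absurd (Fin.le_last _) (not_le.2 h2)
    rcases p.eq_self_or_eq_succAbove l with rfl | ⟨l, rfl⟩
    · rw [insertMax_self] at h1
      exact absurd (Fin.le_last _) (not_le.2 h1)
    simp only [insertMax_succAbove, Fin.castSucc_lt_castSucc_iff, Fin.succAbove_lt_succAbove_iff]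
      at h1 hjl
    rcases p.eq_self_or_eq_succAbove i with rfl | ⟨i, rfl⟩
    · exact absurd (hinc j l ((lt_succAbove_iff _ _).1 hij) hjl) (not_lt.2 h1.le)
    · simp only [insertMax_succAbove, Fin.castSucc_lt_castSucc_iff,
        Fin.succAbove_lt_succAbove_iff] at h2 hij
      exact h i j l hij hjl h1 h2

theorem exists_map_succAbove {n : ℕ} {p : Fin (n + 1)} {A : Finset (Fin (n + 1))} (hp : p ∉ A) :
    ∃ A' : Finset (Fin n), A'.map p.succAboveEmb = A := by
  refine ⟨Finset.univ.filter fun j => p.succAbove j ∈ A, ?_⟩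
  ext x
  simp only [Finset.mem_map, Finset.mem_filter, Finset.mem_univ, true_and,
    Fin.succAboveEmb_apply]
  constructor
  · rintro ⟨j, hj, rfl⟩
    exact hj
  · intro hx
    rcases p.eq_self_or_eq_succAbove x with rfl | ⟨j, rfl⟩
    · exact absurd hx hp
    · exact ⟨j, hx, rfl⟩

theorem notMem_lower_block {n : ℕ} {p : Fin (n + 1)} {π : Equiv.Perm (Fin n)}
    {A B : Finset (Fin (n + 1))} (hA : 1 ≤ A.card)
    (h : ∀ a ∈ A, ∀ b ∈ B, a < b ∧ insertMax p π b < insertMax p π a) : p ∉ B := by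
  intro hp
  obtain ⟨a, ha⟩ := Finset.card_pos.1 hA
  have := (h a ha p hp).2
  rw [insertMax_self] at this
  exact absurd (Fin.le_last _) (not_le.2 this)

theorem HasBlocks.insertMax {e d n : ℕ} {π : Equiv.Perm (Fin n)} (h : HasBlocks e d π)
    (p : Fin (n + 1)) : HasBlocks e d (insertMax p π) := by
  obtain ⟨A, B, hA, hB, hAB⟩ := h
  refine ⟨A.map p.succAboveEmb, B.map p.succAboveEmb, by simpa, by simpa, ?_⟩
  simp only [Finset.mem_map, Fin.succAboveEmb_apply]
  rintro _ ⟨a, ha, rfl⟩ _ ⟨b, hb, rfl⟩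
  simpa using hAB a ha b hb

theorem HasBlocks.of_insertMax {e d n : ℕ} (he : 1 ≤ e) {π : Equiv.Perm (Fin n)}
    {p : Fin (n + 1)} {A B : Finset (Fin (n + 1))} (hA : A.card = e) (hB : B.card = d)
    (h : ∀ a ∈ A, ∀ b ∈ B, a < b ∧ _root_.insertMax p π b < _root_.insertMax p π a)
    (hp : p ∉ A) : HasBlocks e d π := by
  obtain ⟨A, rfl⟩ := exists_map_succAbove hp
  obtain ⟨B, rfl⟩ := exists_map_succAbove (notMem_lower_block (he.trans_eq hA.symm) h)
  rw [Finset.card_map] at hA hB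
  refine ⟨A, B, hA, hB, fun a ha b hb => ?_⟩
  simpa using h (p.succAbove a) (Finset.mem_map_of_mem _ ha) (p.succAbove b)
    (Finset.mem_map_of_mem _ hb)

theorem hasCappedBlocks_insertMax_iff {e d n : ℕ} (he : 1 ≤ e) (hd : 1 ≤ d)
    {π : Equiv.Perm (Fin n)} {p : Fin (n + 1)} (hα : Avoids321 (insertMax p π)) :
    HasCappedBlocks e d (insertMax p π) ↔ HasBlocks e d π := by
  constructor
  · rintro ⟨A, B, m, hA, hB, hAB, hm⟩
    refine HasBlocks.of_insertMax he hA hB hAB fun hp => ?_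
    have := (hm p hp).2
    rw [insertMax_self] at this
    exact absurd (Fin.le_last _) (not_le.2 this)
  · rintro ⟨A, B, hA, hB, hAB⟩
    refine ⟨A.map p.succAboveEmb, B.map p.succAboveEmb, p, by simpa, by simpa, ?_, ?_⟩
    · simp only [Finset.mem_map, Fin.succAboveEmb_apply]
      rintro _ ⟨a, ha, rfl⟩ _ ⟨b, hb, rfl⟩
      simpa using hAB a ha b hb
    · simp only [Finset.mem_map, Fin.succAboveEmb_apply]
      rintro _ ⟨a, ha, rfl⟩
      obtain ⟨b, hb⟩ := Finset.card_pos.1 (hd.trans_eq hB.symm)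
      refine ⟨?_, by simp [Fin.castSucc_lt_last]⟩
      rw [succAbove_lt_iff, ← not_le]
      intro hp
      have := ((avoids_insertMax_iff p π).1 hα).2 a b hp (hAB a ha b hb).1
      exact absurd this (not_lt.2 (hAB a ha b hb).2.le)

/-- The number of larger values to the left of position `q`. -/
def leftInv {n : ℕ} (π : Equiv.Perm (Fin n)) (q : Fin n) : ℕ :=
  (Finset.univ.filter fun j => j < q ∧ π q < π j).card

theorem leftInv_insertMax_self {n : ℕ} (p : Fin (n + 1)) (π : Equiv.Perm (Fin n)) :
    leftInv (insertMax p π) p = 0 := by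
  rw [leftInv, Finset.card_eq_zero, Finset.filter_eq_empty_iff]
  rintro j - ⟨-, h⟩
  rw [insertMax_self] at h
  exact absurd (Fin.le_last _) (not_le.2 h)

theorem leftInv_insertMax_succAbove {n : ℕ} (p : Fin (n + 1)) (π : Equiv.Perm (Fin n))
    (q : Fin n) (h : p ≤ q.castSucc) :
    leftInv (insertMax p π) (p.succAbove q) = leftInv π q + 1 := by
  have : (Finset.univ.filter fun j => j < p.succAbove q ∧
      insertMax p π (p.succAbove q) < insertMax p π j) =
      insert p ((Finset.univ.filter fun j => j < q ∧ π q < π j).map p.succAboveEmb) := by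
    ext x
    rcases p.eq_self_or_eq_succAbove x with rfl | ⟨j, rfl⟩
    · simp [lt_succAbove_iff, h, Fin.castSucc_lt_last]
    · simp [Fin.succAbove_ne]
  rw [leftInv, this, Finset.card_insert_of_notMem (by simp [Fin.succAbove_ne]), Finset.card_map,
    leftInv]

theorem hasBlocks_insertMax_iff {e d n : ℕ} (he : 1 ≤ e) (hd : 1 ≤ d)
    {π : Equiv.Perm (Fin n)} {p : Fin (n + 1)} (hα : Avoids321 (insertMax p π)) :
    HasBlocks e d (insertMax p π) ↔
      HasBlocks e d π ∨ ∃ q : Fin n, q.1 + 1 = p.1 + d ∧ e ≤ leftInv π q + 1 := by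
  have hinc := ((avoids_insertMax_iff p π).1 hα).2
  constructor
  · rintro ⟨A, B, hA, hB, hAB⟩
    by_cases hp : p ∈ A
    swap
    · exact Or.inl (HasBlocks.of_insertMax he hA hB hAB hp)
    right
    obtain ⟨B, rfl⟩ := exists_map_succAbove (notMem_lower_block (he.trans_eq hA.symm) hAB)
    obtain ⟨A', hA'⟩ := exists_map_succAbove (Finset.notMem_erase p A)
    have hcard : A'.card + 1 = e := by
      rw [← Finset.card_map p.succAboveEmb, hA', Finset.card_erase_add_one hp, hA]
    rw [Finset.card_map] at hB
    have hBp : ∀ b ∈ B, p ≤ b.castSucc := fun b hb =>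
      (lt_succAbove_iff _ _).1 (hAB p hp _ (Finset.mem_map_of_mem _ hb)).1
    have hAB' : ∀ a ∈ A', ∀ b ∈ B, a < b ∧ π b < π a := by
      intro a ha b hb
      have ha' : p.succAbove a ∈ A :=
        Finset.mem_of_mem_erase (hA' ▸ Finset.mem_map_of_mem p.succAboveEmb ha)
      simpa using hAB _ ha' _ (Finset.mem_map_of_mem _ hb)
    obtain ⟨b, hb, hbd⟩ : ∃ b ∈ B, p.1 + d ≤ b.1 + 1 := by
      by_contra! hc
      have hsub : B.map Fin.valEmbedding ⊆ Finset.Ico p.1 (p.1 + d - 1) := by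
        intro x hx
        obtain ⟨b, hb, rfl⟩ := Finset.mem_map.1 hx
        have h1 := hc b hb
        have h2 : p.1 ≤ b.1 := hBp b hb
        simp only [Fin.valEmbedding_apply, Finset.mem_Ico]
        omega
      have := Finset.card_le_card hsub
      rw [Finset.card_map, Nat.card_Ico, hB] at this
      omega
    have hqn : p.1 + d - 1 < n := by omega
    refine ⟨⟨p.1 + d - 1, hqn⟩, by simp only; omega, ?_⟩
    rw [← hcard]
    refine Nat.succ_le_succ (Finset.card_le_card fun a ha => ?_)
    have hqb : π ⟨p.1 + d - 1, hqn⟩ ≤ π b := by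
      rcases (show p.1 + d - 1 ≤ b.1 by omega).lt_or_eq with h | h
      · exact (hinc ⟨p.1 + d - 1, hqn⟩ b (by simp only [Fin.le_def, Fin.val_castSucc]; omega) h).le
      · exact le_of_eq (congrArg π (Fin.ext h))
    have hap : a.1 < p.1 := by
      by_contra hc
      have := hinc a b (by simp only [Fin.le_def, Fin.val_castSucc]; omega) (hAB' a ha b hb).1
      exact absurd this (not_lt.2 (hAB' a ha b hb).2.le)
    simp only [Finset.mem_filter, Finset.mem_univ, true_and]
    exact ⟨by simp only [Fin.lt_def]; omega, hqb.trans_lt (hAB' a ha b hb).2⟩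
  · rintro (h | ⟨q, hq, hle⟩)
    · exact h.insertMax p
    obtain ⟨A, hA, hcard⟩ := Finset.exists_subset_card_eq (show e - 1 ≤ leftInv π q by omega)
    have hA' : ∀ a ∈ A, a.1 < p.1 ∧ π q < π a := by
      intro a ha
      have h := (Finset.mem_filter.1 (hA ha)).2
      refine ⟨?_, h.2⟩
      by_contra hc
      have := hinc a q (by simp only [Fin.le_def, Fin.val_castSucc]; omega) h.1
      exact absurd this (not_lt.2 h.2.le)
    have hpq : p.1 ≤ q.1 := by omega
    have hpn : p.1 < n := by omega
    refine ⟨insert p (A.map p.succAboveEmb),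
      (Finset.Icc (⟨p.1, hpn⟩ : Fin n) q).map p.succAboveEmb, ?_, ?_, ?_⟩
    · rw [Finset.card_insert_of_notMem (by simp [Fin.succAbove_ne]), Finset.card_map, hcard]
      omega
    · rw [Finset.card_map, Fin.card_Icc]
      simp only
      omega
    · simp only [Finset.mem_insert, Finset.mem_map, Fin.succAboveEmb_apply, Finset.mem_Icc]
      rintro a ha _ ⟨b, ⟨hpb, hbq⟩, rfl⟩
      have hpb' : p.1 ≤ b.1 := hpb
      rcases ha with rfl | ⟨a, ha, rfl⟩
      · exact ⟨(lt_succAbove_iff _ _).2 hpb', by simp [Fin.castSucc_lt_last]⟩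
      · have h1 := hA' a ha
        have hb : π b ≤ π q := by
          rcases hbq.lt_or_eq with h | h
          · exact (hinc b q hpb' h).le
          · rw [h]
        simp only [Fin.succAbove_lt_succAbove_iff, insertMax_succAbove,
          Fin.castSucc_lt_castSucc_iff]
        exact ⟨by simp only [Fin.lt_def]; omega, hb.trans_lt h1.2⟩

theorem leftInv_insertMax_of_lt {n : ℕ} (p : Fin (n + 1)) (π : Equiv.Perm (Fin n))
    (q : Fin n) (h : q.castSucc < p) :
    leftInv (insertMax p π) (p.succAbove q) = leftInv π q := by
  have : (Finset.univ.filter fun j => j < p.succAbove q ∧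
      insertMax p π (p.succAbove q) < insertMax p π j) =
      (Finset.univ.filter fun j => j < q ∧ π q < π j).map p.succAboveEmb := by
    ext x
    rcases p.eq_self_or_eq_succAbove x with rfl | ⟨j, rfl⟩
    · simp [lt_succAbove_iff, h, Fin.succAbove_ne]
    · simp
  rw [leftInv, this, Finset.card_map, leftInv]

theorem val_succAbove {n : ℕ} (p : Fin (n + 1)) (j : Fin n) :
    (p.succAbove j).1 = if j.1 < p.1 then j.1 else j.1 + 1 := by
  simp only [Fin.succAbove, Fin.lt_def, Fin.val_castSucc]
  split_ifs <;> simp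

/-- `s` is the length of the longest increasing suffix of `π`, and `r` lists, from right to left,
the numbers `leftInv π q` over the positions `q` of that suffix except the first `d - 1`. -/
structure TailState (e d : ℕ) {n : ℕ} (π : Equiv.Perm (Fin n)) (s : ℕ) (r : List ℕ) : Prop where
  avoids : Avoids321 π
  noBlocks : ¬ HasBlocks e d π
  le : s ≤ n
  mono : ∀ i j : Fin n, n ≤ i.1 + s → i < j → π i < π j
  maximal : s < n → ∃ i j : Fin n, n ≤ i.1 + s + 1 ∧ i < j ∧ π j < π i
  length : r.length = s + 1 - d
  entry : ∀ (q : Fin n) (x : ℕ), q.1 + x + 1 = n → x < r.length → r[x]? = some (leftInv π q)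

/-- The effect on a `TailState` of inserting a new largest value with `i` entries to its right;
`none` if this creates a forbidden configuration. -/
def tailStep (e d i s : ℕ) (r : List ℕ) : Option (ℕ × List ℕ) :=
  if i = 0 then some (s + 1, if d ≤ s + 1 then 0 :: r else [])
  else if s < i then none
  else if i < d then some (i, [])
  else if r.getD (i - d) 0 + 1 < e then some (i, (r.take (i + 1 - d)).map Nat.succ)
  else none

theorem TailState.avoids_insertMax_iff {e d n s : ℕ} {r : List ℕ} {π : Equiv.Perm (Fin n)}
    (h : TailState e d π s r) (p : Fin (n + 1)) :
    Avoids321 (insertMax p π) ↔ n - p.1 ≤ s := by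
  rw [_root_.avoids_insertMax_iff]
  constructor
  · rintro ⟨-, hinc⟩
    by_contra hc
    obtain ⟨i, j, hi, hij, hlt⟩ := h.maximal (by omega)
    exact absurd (hinc i j (by simp only [Fin.le_def, Fin.val_castSucc]; omega) hij)
      (not_lt.2 hlt.le)
  · intro hp
    refine ⟨h.avoids, fun i j hpi hij => h.mono i j ?_ hij⟩
    simp only [Fin.le_def, Fin.val_castSucc] at hpi
    omega

theorem TailState.insertMax_last {e d n s : ℕ} (he : 1 ≤ e) (hd : 1 ≤ d) {r : List ℕ}
    {π : Equiv.Perm (Fin n)} (h : TailState e d π s r) {p : Fin (n + 1)} (hp : p.1 = n) :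
    TailState e d (insertMax p π) (s + 1) (if d ≤ s + 1 then 0 :: r else []) := by
  have hα := (h.avoids_insertMax_iff p).2 (by omega)
  have hv : ∀ j : Fin n, (p.succAbove j).1 = j.1 := fun j => by
    rw [val_succAbove, if_pos (by omega)]
  refine ⟨hα, ?_, by have := h.le; omega, ?_, ?_, ?_, ?_⟩
  · rw [hasBlocks_insertMax_iff he hd hα]
    rintro (hc | ⟨q, hq, -⟩)
    · exact h.noBlocks hc
    · omega
  · intro i j hi hij
    rcases p.eq_self_or_eq_succAbove i with rfl | ⟨i, rfl⟩
    · have := j.2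
      simp only [Fin.lt_def] at hij
      omega
    rcases p.eq_self_or_eq_succAbove j with rfl | ⟨j, rfl⟩
    · simp [Fin.castSucc_lt_last]
    · rw [hv] at hi
      simp only [insertMax_succAbove, Fin.castSucc_lt_castSucc_iff,
        Fin.succAbove_lt_succAbove_iff] at hij ⊢
      exact h.mono i j (by omega) hij
  · intro hs
    obtain ⟨i, j, hi, hij, hlt⟩ := h.maximal (by omega)
    refine ⟨p.succAbove i, p.succAbove j, ?_, by simpa, by simpa⟩
    rw [hv]
    omega
  · have := h.length
    split_ifs <;> simp <;> omega
  · intro q x hq hx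
    have hds : d ≤ s + 1 := by
      by_contra hc
      simp [hc] at hx
    rw [if_pos hds] at hx ⊢
    rcases p.eq_self_or_eq_succAbove q with rfl | ⟨q, rfl⟩
    · rw [leftInv_insertMax_self, show x = 0 by omega]
      rfl
    · rw [leftInv_insertMax_of_lt _ _ _ (by simp only [Fin.lt_def, Fin.val_castSucc]; omega)]
      rw [hv] at hq
      obtain ⟨x, rfl⟩ : ∃ y, x = y + 1 := ⟨x - 1, by omega⟩
      simpa using h.entry q x (by omega) (by simpa using hx)

theorem TailState.insertMax_of_lt {e d n s : ℕ} (he : 1 ≤ e) (hd : 1 ≤ d) {r r' : List ℕ}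
    {π : Equiv.Perm (Fin n)} (h : TailState e d π s r) {p : Fin (n + 1)} (hp : p.1 < n)
    (hs : n - p.1 ≤ s) (hr : d ≤ n - p.1 → r.getD (n - p.1 - d) 0 + 1 < e)
    (hr' : r' = (r.take (n - p.1 + 1 - d)).map Nat.succ) :
    TailState e d (insertMax p π) (n - p.1) r' := by
  have hα := (h.avoids_insertMax_iff p).2 hs
  have hinc := ((_root_.avoids_insertMax_iff p π).1 hα).2
  have hlen := h.length
  have hge : ∀ q : Fin n, p.1 < (p.succAbove q).1 → p ≤ q.castSucc := fun q hq => by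
    rwa [← lt_succAbove_iff]
  refine ⟨hα, ?_, by omega, ?_, ?_, ?_, ?_⟩
  · rw [hasBlocks_insertMax_iff he hd hα]
    rintro (hc | ⟨q, hq, hle⟩)
    · exact h.noBlocks hc
    · have := hr (by omega)
      rw [List.getD_eq_getElem?_getD, h.entry q (n - p.1 - d) (by omega) (by omega)] at this
      simp only [Option.getD_some] at this
      omega
  · intro i j hi hij
    rcases p.eq_self_or_eq_succAbove i with rfl | ⟨i, rfl⟩
    · omega
    rcases p.eq_self_or_eq_succAbove j with rfl | ⟨j, rfl⟩
    · simp [Fin.castSucc_lt_last]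
    · have := hge i (by omega)
      simp only [insertMax_succAbove, Fin.castSucc_lt_castSucc_iff,
        Fin.succAbove_lt_succAbove_iff] at hij ⊢
      exact hinc i j this hij
  · intro _
    refine ⟨p, p.succAbove ⟨p.1, hp⟩, by omega, ?_, by simp [Fin.castSucc_lt_last]⟩
    rw [lt_succAbove_iff]
    simp
  · rw [hr', List.length_map, List.length_take]
    omega
  · intro q x hq hx
    rw [hr', List.length_map, List.length_take] at hx
    rcases p.eq_self_or_eq_succAbove q with rfl | ⟨q, rfl⟩
    · omega
    have hpq := hge q (by omega)
    rw [leftInv_insertMax_succAbove _ _ _ hpq, hr', List.getElem?_map,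
      List.getElem?_take_of_lt (by omega), h.entry q x ?_ (by omega)]
    · rfl
    · rw [val_succAbove, if_neg] at hq
      · omega
      · simpa [Fin.le_def] using hpq

theorem TailState.of_tailStep {e d n s : ℕ} (he : 1 ≤ e) (hd : 1 ≤ d) {r : List ℕ}
    {π : Equiv.Perm (Fin n)} (h : TailState e d π s r) {p : Fin (n + 1)} {y : ℕ × List ℕ}
    (hy : tailStep e d (n - p.1) s r = some y) : TailState e d (insertMax p π) y.1 y.2 := by
  unfold tailStep at hy
  split_ifs at hy with h0 hs hi hid hr <;> simp only [Option.some.injEq] at hy <;> subst hy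
  · have := h.insertMax_last he hd (p := p) (by omega)
    rwa [if_pos hs] at this
  · have := h.insertMax_last he hd (p := p) (by omega)
    rwa [if_neg hs] at this
  · exact h.insertMax_of_lt he hd (by omega) (by omega) (by omega)
      (by rw [show n - p.1 + 1 - d = 0 by omega]; simp)
  · exact h.insertMax_of_lt he hd (by omega) (by omega) (fun _ => hr) rfl

theorem TailState.tailStep_eq_none {e d n s : ℕ} (he : 1 ≤ e) (hd : 1 ≤ d) {r : List ℕ}
    {π : Equiv.Perm (Fin n)} (h : TailState e d π s r) {p : Fin (n + 1)}
    (hy : tailStep e d (n - p.1) s r = none) (hα : Avoids321 (insertMax p π)) :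
    HasBlocks e d (insertMax p π) := by
  rw [hasBlocks_insertMax_iff he hd hα]
  have hs := (h.avoids_insertMax_iff p).1 hα
  have hlen := h.length
  unfold tailStep at hy
  split_ifs at hy with h0 h1 h2 h3
  · omega
  · refine Or.inr ⟨⟨p.1 + d - 1, by omega⟩, by simp only; omega, ?_⟩
    have := h.entry ⟨p.1 + d - 1, by omega⟩ (n - p.1 - d) (by simp only; omega) (by omega)
    rw [List.getD_eq_getElem?_getD, this] at h3
    simp only [Option.getD_some] at h3
    omega

/-- The `TailState` of a permutation, and `none` if it has a forbidden configuration. -/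
noncomputable def tailState (e d : ℕ) : (n : ℕ) → Equiv.Perm (Fin n) → Option (ℕ × List ℕ)
  | 0, _ => some (0, [])
  | n + 1, α =>
    let x := (insertMaxEquiv n).symm α
    (tailState e d n x.2).bind fun y => tailStep e d (n - x.1.1) y.1 y.2

theorem tailState_insertMax (e d : ℕ) {n : ℕ} (p : Fin (n + 1)) (π : Equiv.Perm (Fin n)) :
    tailState e d (n + 1) (insertMax p π) =
      (tailState e d n π).bind fun y => tailStep e d (n - p.1) y.1 y.2 := by
  rw [tailState, ← insertMaxEquiv_apply, Equiv.symm_apply_apply]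

theorem tailState_spec {e d : ℕ} (he : 1 ≤ e) (hd : 1 ≤ d) (n : ℕ) (π : Equiv.Perm (Fin n)) :
    (∀ y, tailState e d n π = some y → TailState e d π y.1 y.2) ∧
      (tailState e d n π = none → Avoids321 π → HasBlocks e d π) := by
  induction n with
  | zero =>
    refine ⟨?_, by simp [tailState]⟩
    rintro y hy
    simp only [tailState, Option.some.injEq] at hy
    subst hy
    refine ⟨fun i => i.elim0, ?_, le_rfl, fun i => i.elim0, fun h => by simp at h, ?_,
      fun i => i.elim0⟩
    · rintro ⟨A, B, hA, -, -⟩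
      rw [Finset.eq_empty_of_isEmpty A, Finset.card_empty] at hA
      omega
    · simp only [List.length_nil]
      omega
  | succ n ih =>
    obtain ⟨⟨p, π⟩, rfl⟩ := (insertMaxEquiv n).surjective π
    rw [insertMaxEquiv_apply, tailState_insertMax]
    obtain ⟨ih1, ih2⟩ := ih π
    cases hπ : tailState e d n π with
    | none =>
      refine ⟨by simp, fun _ hα => ?_⟩
      exact (ih2 hπ ((avoids_insertMax_iff p π).1 hα).1).insertMax p
    | some y =>
      exact ⟨fun z hz => (ih1 y hπ).of_tailStep he hd hz,
        fun hz hα => (ih1 y hπ).tailStep_eq_none he hd hz hα⟩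

/-- The transfer operator of the walk on tail states. -/
def transfer (e d : ℕ) (G : ℕ → List ℕ → ℤ) (s : ℕ) (r : List ℕ) : ℤ :=
  ∑ i ∈ Finset.range (s + 1), (tailStep e d i s r).elim 0 fun y => G y.1 y.2

theorem sum_fin_sub {n s : ℕ} (hs : s ≤ n) (f : ℕ → ℤ) (hf : ∀ i, s < i → f i = 0) :
    ∑ p : Fin (n + 1), f (n - p.1) = ∑ i ∈ Finset.range (s + 1), f i := by
  rw [Finset.sum_range (n := n + 1) (f := fun p => f (n - p)) |>.symm,
    ← Finset.sum_range_reflect]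
  symm
  apply Finset.sum_subset_zero_on_sdiff
  · intro i hi
    simp only [Finset.mem_range] at hi ⊢
    omega
  · intro i hi
    simp only [Finset.mem_sdiff, Finset.mem_range] at hi
    exact hf _ (by omega)
  · intro i hi
    simp only [Finset.mem_range] at hi
    congr 1
    omega

theorem sum_tailState {e d : ℕ} (he : 1 ≤ e) (hd : 1 ≤ d) (n : ℕ) (G : ℕ → List ℕ → ℤ) :
    ∑ π : Equiv.Perm (Fin n), (tailState e d n π).elim 0 (fun y => G y.1 y.2) =
      (transfer e d)^[n] G 0 [] := by
  induction n generalizing G with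
  | zero => simp [tailState]
  | succ n ih =>
    rw [Function.iterate_succ_apply, ← ih, ← (insertMaxEquiv n).sum_comp, Fintype.sum_prod_type,
      Finset.sum_comm]
    refine Finset.sum_congr rfl fun π _ => ?_
    simp only [insertMaxEquiv_apply, tailState_insertMax]
    cases hπ : tailState e d n π with
    | none => simp
    | some y =>
      have hy := ((tailState_spec he hd n π).1 y hπ).le
      simp only [Option.bind_some, Option.elim_some, transfer]
      rw [sum_fin_sub hy (fun i => (tailStep e d i y.1 y.2).elim 0 fun y => G y.1 y.2)]
      intro i hi
      rw [tailStep, if_neg (by omega), if_pos hi]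
      rfl

theorem x1_succ {e d : ℕ} (he : 1 ≤ e) (hd : 1 ≤ d) (n : ℕ) :
    (x1 (e + d + 1) d (n + 1) : ℤ) = (transfer e d)^[n] (fun s _ => (s : ℤ) + 1) 0 [] := by
  classical
  rw [← sum_tailState he hd, x1]
  simp only [avoids_X1_iff he hd]
  rw [Nat.card_eq_fintype_card, Fintype.card_subtype, Finset.natCast_card_filter,
    ← (insertMaxEquiv n).sum_comp, Fintype.sum_prod_type, Finset.sum_comm]
  refine Finset.sum_congr rfl fun π _ => ?_
  simp only [insertMaxEquiv_apply]
  obtain ⟨h1, h2⟩ := tailState_spec he hd n π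
  cases hπ : tailState e d n π with
  | none =>
    refine Finset.sum_eq_zero fun p _ => if_neg ?_
    rintro ⟨hα, hb⟩
    rw [hasCappedBlocks_insertMax_iff he hd hα] at hb
    exact hb (h2 hπ ((avoids_insertMax_iff p π).1 hα).1)
  | some y =>
    have hy := h1 y hπ
    have hiff : ∀ p : Fin (n + 1), (Avoids321 (insertMax p π) ∧
        ¬ HasCappedBlocks e d (insertMax p π)) ↔ n - p.1 ≤ y.1 := by
      intro p
      rw [← hy.avoids_insertMax_iff p]
      refine ⟨And.left, fun hα => ⟨hα, ?_⟩⟩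
      rw [hasCappedBlocks_insertMax_iff he hd hα]
      exact hy.noBlocks
    simp only [hiff]
    rw [sum_fin_sub hy.le (fun i => if i ≤ y.1 then (1 : ℤ) else 0)
      (fun i hi => if_neg (by omega))]
    rw [Finset.sum_congr rfl fun i hi => if_pos (by simp only [Finset.mem_range] at hi; omega)]
    simp

theorem x1_zero (e d : ℕ) (he : 1 ≤ e) (hd : 1 ≤ d) : x1 (e + d + 1) d 0 = 1 := by
  rw [x1]
  simp only [avoids_X1_iff he hd]
  have : ∀ π : Equiv.Perm (Fin 0), Avoids321 π ∧ ¬ HasCappedBlocks e d π :=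
    fun π => ⟨fun i => i.elim0, fun ⟨_, _, m, _⟩ => m.elim0⟩
  simp [this]

/-- The sum of `G` over the nonempty prefixes of a list with all entries increased by one,
restricted to the prefixes whose last entry stays below `e`. -/
def prefixSum (e : ℕ) : (List ℕ → ℤ) → List ℕ → ℤ
  | _, [] => 0
  | G, a :: t => (if a + 1 < e then G [a + 1] else 0) + prefixSum e (fun m => G ((a + 1) :: m)) t

theorem prefixSum_eq_sum (e : ℕ) (G : List ℕ → ℤ) (r : List ℕ) :
    prefixSum e G r = ∑ i ∈ Finset.range r.length,
      if r.getD i 0 + 1 < e then G ((r.take (i + 1)).map Nat.succ) else 0 := by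
  induction r generalizing G with
  | nil => simp [prefixSum]
  | cons a t ih =>
    rw [prefixSum, ih, List.length_cons, Finset.sum_range_succ', add_comm]
    simp

theorem prefixSum_add (e : ℕ) (G H : List ℕ → ℤ) (r : List ℕ) :
    prefixSum e (fun m => G m + H m) r = prefixSum e G r + prefixSum e H r := by
  simp only [prefixSum_eq_sum, ← Finset.sum_add_distrib]
  refine Finset.sum_congr rfl fun i _ => ?_
  split_ifs <;> simp

theorem prefixSum_sum {ι : Type*} (e : ℕ) (S : Finset ι) (G : ι → List ℕ → ℤ) (r : List ℕ) :
    prefixSum e (fun m => ∑ x ∈ S, G x m) r = ∑ x ∈ S, prefixSum e (G x) r := by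
  simp only [prefixSum_eq_sum]
  rw [Finset.sum_comm]
  refine Finset.sum_congr rfl fun i _ => ?_
  split_ifs <;> simp

theorem prefixSum_mul (e : ℕ) (G : List ℕ → ℤ) (c : ℤ) (r : List ℕ) :
    prefixSum e (fun m => G m * c) r = prefixSum e G r * c := by
  simp only [prefixSum_eq_sum, Finset.sum_mul]
  refine Finset.sum_congr rfl fun i _ => ?_
  split_ifs <;> simp

/-- The transfer operator on the list component of a tail state. -/
def listTransfer (e : ℕ) (G : List ℕ → ℤ) (r : List ℕ) : ℤ :=
  G (0 :: r) + prefixSum e G r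

theorem transfer_of_lt (e : ℕ) {d s : ℕ} (hs : s < d) (G : ℕ → List ℕ → ℤ) :
    transfer e d G s [] =
      ∑ i ∈ Finset.range (s + 1), G (i + 1) (if d ≤ i + 1 then [0] else []) := by
  rw [transfer, Finset.sum_range_succ', Finset.sum_range_succ]
  congr 1
  refine Finset.sum_congr rfl fun i hi => ?_
  rw [Finset.mem_range] at hi
  rw [tailStep, if_neg (by omega), if_neg (by omega), if_pos (by omega), if_neg (by omega)]
  rfl

theorem transfer_of_ne_nil (e : ℕ) {d : ℕ} (hd : 1 ≤ d) (G : ℕ → List ℕ → ℤ) {r : List ℕ}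
    (hr : r ≠ []) :
    transfer e d G (d - 1 + r.length) r =
      listTransfer e (fun r => G (d - 1 + r.length) r) r +
        ∑ i ∈ Finset.range (d - 1), G (i + 1) [] := by
  have hpos := List.length_pos_iff.2 hr
  rw [transfer, Finset.sum_range_succ', Finset.sum_range_add, listTransfer, prefixSum_eq_sum]
  have h0 : (tailStep e d 0 (d - 1 + r.length) r).elim 0 (fun y => G y.1 y.2) =
      G (d - 1 + (0 :: r).length) (0 :: r) := by
    rw [tailStep, if_pos rfl, if_pos (by omega)]
    rfl
  have h1 : ∀ i ∈ Finset.range (d - 1),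
      (tailStep e d (i + 1) (d - 1 + r.length) r).elim 0 (fun y => G y.1 y.2) =
        G (i + 1) [] := by
    intro i hi
    rw [Finset.mem_range] at hi
    rw [tailStep, if_neg (by omega), if_neg (by omega), if_pos (by omega)]
    rfl
  have h2 : ∀ i ∈ Finset.range r.length,
      (tailStep e d (d - 1 + i + 1) (d - 1 + r.length) r).elim 0 (fun y => G y.1 y.2) =
        if r.getD i 0 + 1 < e then G (d - 1 + ((r.take (i + 1)).map Nat.succ).length)
          ((r.take (i + 1)).map Nat.succ) else 0 := by
    intro i hi
    rw [Finset.mem_range] at hi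
    have hl : ((r.take (i + 1)).map Nat.succ).length = i + 1 := by
      rw [List.length_map, List.length_take]
      omega
    rw [tailStep, if_neg (by omega), if_neg (by omega), if_neg (by omega), hl,
      show d - 1 + i + 1 - d = i by omega, show d - 1 + i + 1 + 1 - d = i + 1 by omega]
    split_ifs <;> rfl
  rw [h0, Finset.sum_congr rfl h1, Finset.sum_congr rfl h2]
  ring

/-- Weighted walks from the small states `s ≤ d`. -/
def smallWalk (e d n s : ℕ) : ℤ :=
  (transfer e d)^[n] (fun s _ => (s : ℤ) + 1) s (if d ≤ s then [0] else [])

/-- Total weight of the states below `d` reached after a return from the list states. -/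
def returnWeight (e d : ℕ) : ℕ → ℤ
  | 0 => (d - 1 : ℕ)
  | n + 1 => ∑ i ∈ Finset.range (d - 1), smallWalk e d n (i + 1)

theorem smallWalk_zero (e d s : ℕ) : smallWalk e d 0 s = s + 1 := rfl

theorem smallWalk_succ (e : ℕ) {d s : ℕ} (n : ℕ) (hs : s < d) :
    smallWalk e d (n + 1) s = ∑ i ∈ Finset.range (s + 1), smallWalk e d n (i + 1) := by
  rw [smallWalk, if_neg (by omega), Function.iterate_succ_apply', transfer_of_lt e hs]
  rfl

theorem iterate_transfer_of_ne_nil (e : ℕ) {d : ℕ} (hd : 1 ≤ d) (n : ℕ) {r : List ℕ}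
    (hr : r ≠ []) :
    (transfer e d)^[n] (fun s _ => (s : ℤ) + 1) (d - 1 + r.length) r =
      (listTransfer e)^[n] (fun r => (r.length : ℤ) + 1) r +
        ∑ x ∈ Finset.HasAntidiagonal.antidiagonal n,
          (listTransfer e)^[x.1] (fun _ => 1) r * returnWeight e d x.2 := by
  induction n generalizing r with
  | zero =>
    simp [returnWeight]
    ring
  | succ n ih =>
    have hsmall : ∑ i ∈ Finset.range (d - 1),
        (transfer e d)^[n] (fun s _ => (s : ℤ) + 1) (i + 1) [] = returnWeight e d (n + 1) := by
      rw [returnWeight]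
      refine Finset.sum_congr rfl fun i hi => ?_
      rw [Finset.mem_range] at hi
      rw [smallWalk, if_neg (by omega)]
    have hpre : ∀ G H : List ℕ → ℤ, (∀ r, r ≠ [] → G r = H r) →
        prefixSum e G r = prefixSum e H r := by
      intro G H hGH
      simp only [prefixSum_eq_sum]
      refine Finset.sum_congr rfl fun i _ => ?_
      rw [hGH]
      simp [hr]
    rw [Function.iterate_succ_apply', transfer_of_ne_nil e hd _ hr, hsmall, listTransfer,
      ih (by simp), hpre _ _ fun r hr => ih hr, prefixSum_add, prefixSum_sum,
      Finset.Nat.sum_antidiagonal_succ, Function.iterate_succ_apply', listTransfer]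
    simp only [prefixSum_mul, Function.iterate_succ_apply', listTransfer, Function.iterate_zero,
      id, add_mul, Finset.sum_add_distrib]
    ring

/-- The transfer operator that appends an entry to the inversion sequence of a permutation; the
state is the last entry together with the preceding ones back to the last ascent. -/
def rightStep (e : ℕ) (G : ℕ → List ℕ → ℤ) (a : ℕ) (t : List ℕ) : ℤ :=
  ∑ b ∈ Finset.range (a + 1), G b (a :: t) + if a + 1 < e then G (a + 1) [] else 0

theorem iterate_rightStep_congr {e : ℕ} (n : ℕ) {G H : ℕ → List ℕ → ℤ}
    (h : ∀ a t, a < e → G a t = H a t) {a : ℕ} (ha : a < e) (t : List ℕ) :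
    (rightStep e)^[n] G a t = (rightStep e)^[n] H a t := by
  induction n generalizing a t with
  | zero => exact h a t ha
  | succ n ih =>
    rw [Function.iterate_succ_apply', Function.iterate_succ_apply', rightStep, rightStep]
    congr 1
    · refine Finset.sum_congr rfl fun b hb => ih ?_ _
      rw [Finset.mem_range] at hb
      omega
    · split_ifs with h1
      · exact ih h1 _
      · rfl

theorem iterate_rightStep_add (e n : ℕ) (G H : ℕ → List ℕ → ℤ) (a : ℕ) (t : List ℕ) :
    (rightStep e)^[n] (fun a t => G a t + H a t) a t =
      (rightStep e)^[n] G a t + (rightStep e)^[n] H a t := by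
  induction n generalizing a t with
  | zero => rfl
  | succ n ih =>
    simp only [Function.iterate_succ_apply', rightStep, ih, Finset.sum_add_distrib]
    split_ifs <;> ring

/-- Appending a positive entry at the right has the same total effect as the moves of
`prefixSum`. -/
theorem iterate_rightStep_prefixSum {e : ℕ} (he : 1 ≤ e) (n : ℕ) (G : List ℕ → ℤ) :
    (rightStep e)^[n] (fun a t => ∑ b ∈ Finset.range a, G ((b + 1) :: a :: t) +
        if a + 1 < e then G [a + 1] else 0) 0 [] =
      (rightStep e)^[n] (fun a t => prefixSum e G (a :: t)) 0 [] := by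
  induction n generalizing G with
  | zero => simp [prefixSum]
  | succ n ih =>
    let G' : List ℕ → ℤ := fun m => ∑ c ∈ Finset.range (m.headD 0), G ((c + 1) :: m)
    let H : ℕ → List ℕ → ℤ := fun a _ =>
      ∑ b ∈ Finset.range (a + 1), (if b + 1 < e then G [b + 1] else 0) +
        if a + 1 < e then (if a + 1 + 1 < e then G [a + 1 + 1] else 0) else 0
    rw [Function.iterate_succ_apply, Function.iterate_succ_apply]
    trans (rightStep e)^[n] (fun a t => (∑ b ∈ Finset.range a, G' ((b + 1) :: a :: t) +
        if a + 1 < e then G' [a + 1] else 0) + H a t) 0 []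
    · refine iterate_rightStep_congr n (fun a t ha => ?_) he []
      simp only [rightStep, G', H, List.headD_cons, Finset.sum_add_distrib]
      rw [Finset.sum_range_succ' (fun b => ∑ c ∈ Finset.range b, G ((c + 1) :: b :: a :: t)) a]
      split_ifs <;> simp <;> ring
    · rw [iterate_rightStep_add, ih, ← iterate_rightStep_add]
      refine iterate_rightStep_congr n (fun a t ha => ?_) he []
      simp only [rightStep, G', H, List.headD_cons, prefixSum, Finset.sum_add_distrib,
        prefixSum_sum]
      split_ifs <;> simp <;> ring

theorem iterate_listTransfer {e : ℕ} (he : 1 ≤ e) (n : ℕ) (G : List ℕ → ℤ) :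
    (listTransfer e)^[n] G [0] = (rightStep e)^[n] (fun a t => G (a :: t)) 0 [] := by
  induction n generalizing G with
  | zero => rfl
  | succ n ih =>
    rw [Function.iterate_succ_apply, ih, Function.iterate_succ_apply]
    simp only [listTransfer]
    rw [iterate_rightStep_add, ← iterate_rightStep_prefixSum he, ← iterate_rightStep_add]
    refine iterate_rightStep_congr n (fun a t ha => ?_) he []
    rw [rightStep, Finset.sum_range_succ']
    ring

/-- Numbers of extensions of an inversion sequence ending in `a` with entries below `e`. -/
def boundedExt (e : ℕ) : ℕ → ℕ → ℤ
  | 0, _ => 1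
  | n + 1, a => ∑ b ∈ Finset.range (a + 1), boundedExt e n b +
      if a + 1 < e then boundedExt e n (a + 1) else 0

/-- Numbers of weakly decreasing extensions of a sequence ending in `a`. -/
def decreasingExt : ℕ → ℕ → ℤ
  | 0, _ => 1
  | n + 1, a => ∑ b ∈ Finset.range (a + 1), decreasingExt n b

/-- Extensions as in `boundedExt`, weighted by one plus the length of the final descending part. -/
def weightedExt (e : ℕ) : ℕ → ℕ → ℤ
  | 0, _ => 2
  | n + 1, a => ∑ b ∈ Finset.range (a + 1), (weightedExt e n b + decreasingExt n b) +
      if a + 1 < e then weightedExt e n (a + 1) else 0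

theorem iterate_rightStep_one (e n a : ℕ) (t : List ℕ) :
    (rightStep e)^[n] (fun _ _ => 1) a t = boundedExt e n a := by
  induction n generalizing a t with
  | zero => rfl
  | succ n ih => simp only [Function.iterate_succ_apply', rightStep, ih, boundedExt]

theorem iterate_rightStep_length (e n a : ℕ) (t : List ℕ) :
    (rightStep e)^[n] (fun _ t => (t.length : ℤ) + 2) a t =
      weightedExt e n a + t.length * decreasingExt n a := by
  induction n generalizing a t with
  | zero =>
    simp [weightedExt, decreasingExt]
    ring
  | succ n ih =>
    simp only [Function.iterate_succ_apply', rightStep, ih, weightedExt, decreasingExt,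
      List.length_cons, List.length_nil, Finset.sum_add_distrib, Finset.mul_sum]
    push_cast
    simp only [add_mul, one_mul, Finset.sum_add_distrib]
    split_ifs <;> simp <;> ring

theorem smallWalk_self {e d : ℕ} (he : 1 ≤ e) (hd : 1 ≤ d) (n : ℕ) :
    smallWalk e d n d = weightedExt e n 0 + ∑ x ∈ Finset.HasAntidiagonal.antidiagonal n,
      boundedExt e x.1 0 * returnWeight e d x.2 := by
  have h := iterate_transfer_of_ne_nil e hd n (r := [0]) (by simp)
  rw [List.length_singleton, Nat.sub_add_cancel hd] at h
  rw [smallWalk, if_pos le_rfl, h]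
  congr 1
  · rw [iterate_listTransfer he]
    have := iterate_rightStep_length e n 0 []
    simp only [List.length_nil, Nat.cast_zero, zero_mul, add_zero] at this
    rw [← this]
    congr 1
  · refine Finset.sum_congr rfl fun x _ => ?_
    rw [iterate_listTransfer he, iterate_rightStep_one]

section GeneratingFunctions

open PowerSeries

/-- The Fibonacci-type polynomials `p n`, as power series, with
`p (n + 2) = p (n + 1) - X * p n`. -/
noncomputable def fibSeries : ℕ → ℤ⟦X⟧
  | 0 => 0
  | 1 => 1
  | n + 2 => fibSeries (n + 1) - X * fibSeries n

theorem fibSeries_add_two (n : ℕ) :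
    fibSeries (n + 2) = fibSeries (n + 1) - X * fibSeries n := by
  rw [fibSeries]

theorem coeff_fibSeries (n j : ℕ) :
    coeff j (fibSeries (n + 1)) = (-1) ^ j * ((n - j).choose j : ℤ) := by
  induction n using Nat.twoStepInduction generalizing j with
  | zero => cases j <;> simp [fibSeries, coeff_one]
  | one =>
    rcases j with _ | _ | j <;> simp [fibSeries, coeff_one]
  | more n ih1 ih2 =>
    rw [fibSeries_add_two, map_sub, ih2]
    rcases j with _ | j
    · simp
    · rw [coeff_succ_X_mul, ih1]
      by_cases h : j ≤ n
      · rw [show n + 1 - (j + 1) = n - j by omega, show n + 2 - (j + 1) = n - j + 1 by omega,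
          Nat.choose_succ_succ]
        push_cast
        ring
      · rw [Nat.choose_eq_zero_of_lt (by omega), Nat.choose_eq_zero_of_lt (by omega),
          Nat.choose_eq_zero_of_lt (by omega)]
        simp

theorem fibSeries_mul_sub (m n : ℕ) :
    fibSeries (m + 2) * fibSeries (n + 2) - X ^ 2 * (fibSeries m * fibSeries n) =
      fibSeries (m + n + 2) := by
  induction n using Nat.twoStepInduction with
  | zero => simp [fibSeries]
  | one =>
    have h1 := fibSeries_add_two (m + 1)
    have h2 := fibSeries_add_two m
    rw [show m + 1 + 2 = m + 3 by omega] at h1 ⊢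
    rw [h1, fibSeries_add_two 1, show 1 + 1 = 0 + 2 by rfl, fibSeries_add_two 0, fibSeries,
      fibSeries]
    rw [show m + 1 + 1 = m + 2 by rfl, h2]
    ring
  | more n ih1 ih2 =>
    have h1 := fibSeries_add_two (m + n + 2)
    rw [show m + (n + 2) + 2 = m + n + 2 + 2 by omega, h1,
      show m + n + 2 + 1 = m + (n + 1) + 2 by omega, ← ih1, ← ih2, fibSeries_add_two (n + 2),
      fibSeries_add_two n, show n + 2 + 1 = n + 1 + 2 by omega]
    ring

/-- Solutions of the recurrence of `fibSeries` in terms of their initial values. -/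
theorem eq_fibSeries_of_recurrence {N : ℕ} {g : ℕ → ℤ⟦X⟧}
    (hg : ∀ s, s + 2 ≤ N → g (s + 2) = g (s + 1) - X * g s) {s : ℕ} (hs : s + 1 ≤ N) :
    g (s + 1) = fibSeries (s + 1) * g 1 - X * (fibSeries s * g 0) := by
  induction s using Nat.twoStepInduction with
  | zero => simp [fibSeries]
  | one =>
    rw [hg 0 hs]
    simp [fibSeries]
  | more s ih1 ih2 =>
    rw [hg (s + 1) hs, ih1 (by omega), ih2 (by omega), fibSeries_add_two (s + 1),
      fibSeries_add_two s]
    ring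

theorem mk_eq_of_succ {f h : ℕ → ℤ} {c : ℤ} (h0 : f 0 = c) (hs : ∀ n, f (n + 1) = h n) :
    mk f = C c + X * mk h := by
  ext n
  cases n with
  | zero => simp [h0]
  | succ n => rw [map_add, coeff_succ_X_mul, coeff_C, coeff_mk, coeff_mk, hs]; simp

theorem mk_sum {ι : Type*} (S : Finset ι) (f : ι → ℕ → ℤ) :
    mk (fun n => ∑ i ∈ S, f i n) = ∑ i ∈ S, mk (f i) := by
  ext n
  simp

theorem mk_decreasingExt (a : ℕ) :
    mk (fun n => decreasingExt n a) = (mk 1 : ℤ⟦X⟧) ^ (a + 1) := by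
  have hrec : ∀ a, mk (fun n => decreasingExt n a) =
      1 + X * ∑ b ∈ Finset.range (a + 1), mk (fun n => decreasingExt n b) := by
    intro a
    rw [mk_eq_of_succ (h := fun n => ∑ b ∈ Finset.range (a + 1), decreasingExt n b) rfl
      fun n => rfl, mk_sum]
    rfl
  induction a with
  | zero =>
    have h := hrec 0
    rw [Finset.sum_range_one] at h
    linear_combination (mk 1 : ℤ⟦X⟧) * h -
      mk (fun n => decreasingExt n 0) * mk_one_mul_one_sub_eq_one ℤ
  | succ a ih =>
    have h := hrec (a + 1)
    rw [Finset.sum_range_succ] at h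
    have h' := hrec a
    rw [ih] at h'
    linear_combination (mk 1 : ℤ⟦X⟧) * h -
      mk (fun n => decreasingExt n (a + 1)) * mk_one_mul_one_sub_eq_one ℤ - (mk 1 : ℤ⟦X⟧) * h'

/-- Elimination for the systems `q a = 1 + X * ∑ b ≤ a, q b + X * q (a + 1)`. -/
theorem fibSeries_mul_of_system {e : ℕ} {q : ℕ → ℤ⟦X⟧}
    (hq : ∀ a < e, q a = 1 + X * ∑ b ∈ Finset.range (a + 1), q b + X * q (a + 1)) :
    fibSeries (e + 2) * (1 + X * q 0) = fibSeries (e + 1) + X ^ (e + 1) * q e := by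
  let g : ℕ → ℤ⟦X⟧
    | 0 => 1
    | 1 => X * (1 + X * q 0)
    | a + 2 => X ^ (a + 2) * q a
  have hg : ∀ s, s + 2 ≤ e + 2 → g (s + 2) = g (s + 1) - X * g s := by
    intro s hs
    rcases s with _ | _ | s
    · simp only [g]
      ring
    · simp only [g]
      have h := hq 0 (by omega)
      rw [Finset.sum_range_one] at h
      linear_combination (-X ^ 2) * h
    · simp only [g]
      have h := hq s (by omega)
      have h' := hq (s + 1) (by omega)
      rw [Finset.sum_range_succ] at h'
      linear_combination X ^ (s + 3) * (h - h')
  have h := eq_fibSeries_of_recurrence hg (s := e + 1) le_rfl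
  simp only [g] at h
  have hX : (X : ℤ⟦X⟧) ≠ 0 := X_ne_zero
  refine mul_left_cancel₀ hX ?_
  linear_combination -h

theorem fibSeries_mul_boundedExt {e : ℕ} (he : 1 ≤ e) :
    fibSeries (e + 2) * (1 + X * mk fun n => boundedExt e n 0) = fibSeries (e + 1) := by
  let q : ℕ → ℤ⟦X⟧ := fun a => if a < e then mk fun n => boundedExt e n a else 0
  have h := fibSeries_mul_of_system (e := e) (q := q) fun a ha => by
    have hsum : ∑ b ∈ Finset.range (a + 1), q b =
        ∑ b ∈ Finset.range (a + 1), mk (fun n => boundedExt e n b) := by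
      refine Finset.sum_congr rfl fun b hb => if_pos ?_
      rw [Finset.mem_range] at hb
      omega
    rw [hsum]
    simp only [q, if_pos ha]
    ext n
    cases n with
    | zero => split_ifs <;> simp [boundedExt]
    | succ n =>
      split_ifs with h1 <;> simp [boundedExt, h1, coeff_succ_X_mul, coeff_one]
  simp only [q, if_pos (show 0 < e from he), lt_irrefl, if_false] at h
  rw [h, mul_zero, add_zero]

theorem fibSeries_mul_weightedExt {e : ℕ} (he : 1 ≤ e) :
    fibSeries (e + 2) * (1 + X + X ^ 2 * mk fun n => weightedExt e n 0) =
      fibSeries (e + 1) + X ^ (e + 1) * mk 1 ^ e := by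
  have hι := mk_one_mul_one_sub_eq_one ℤ
  let q : ℕ → ℤ⟦X⟧ := fun a =>
    (if a < e then X * mk fun n => weightedExt e n a else 0) + mk 1 ^ a
  have hgeom : ∀ a, X * ∑ b ∈ Finset.range (a + 1), (mk 1 : ℤ⟦X⟧) ^ b = X + mk 1 ^ a - 1 := by
    intro a
    induction a with
    | zero => simp
    | succ a ih =>
      rw [Finset.sum_range_succ, mul_add, ih]
      linear_combination (-mk 1 ^ a) * hι
  have h := fibSeries_mul_of_system (e := e) (q := q) fun a ha => by
    have hsum : ∑ b ∈ Finset.range (a + 1), q b =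
        X * ∑ b ∈ Finset.range (a + 1), mk (fun n => weightedExt e n b) +
          ∑ b ∈ Finset.range (a + 1), mk 1 ^ b := by
      rw [Finset.mul_sum, ← Finset.sum_add_distrib]
      refine Finset.sum_congr rfl fun b hb => ?_
      rw [Finset.mem_range] at hb
      simp only [q]
      rw [if_pos (by omega)]
    have hrec : mk (fun n => weightedExt e n a) = 1 + mk 1 ^ (a + 1) +
        X * ∑ b ∈ Finset.range (a + 1), mk (fun n => weightedExt e n b) +
        if a + 1 < e then X * mk fun n => weightedExt e n (a + 1) else 0 := by
      have hdec := mk_eq_of_succ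
        (h := fun n => ∑ b ∈ Finset.range (a + 1), decreasingExt n b) (c := 1)
        (f := fun n => decreasingExt n a) rfl fun n => rfl
      rw [mk_decreasingExt] at hdec
      rw [hdec]
      ext n
      cases n with
      | zero => split_ifs <;> simp [weightedExt]
      | succ n =>
        split_ifs with h1 <;>
          simp [weightedExt, h1, coeff_succ_X_mul, coeff_one, Finset.sum_add_distrib] <;> ring
    simp only [hsum, mul_add, hgeom]
    simp only [q]
    rw [if_pos ha, hrec]
    split_ifs <;> ring
  simp only [q, if_pos (show 0 < e from he), lt_irrefl, if_false] at h
  linear_combination h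

/-- The series `1 + X * ∑ n, smallWalk e d n s * X ^ n`. -/
noncomputable def walkSeries (e d s : ℕ) : ℤ⟦X⟧ :=
  1 + X * mk fun n => smallWalk e d n s

theorem sum_walkSeries (e d m : ℕ) :
    ∑ i ∈ Finset.range m, walkSeries e d (i + 1) =
      (m : ℤ⟦X⟧) + X * mk fun n => ∑ i ∈ Finset.range m, smallWalk e d n (i + 1) := by
  simp [walkSeries, Finset.sum_add_distrib, mk_sum, Finset.mul_sum]

theorem mk_eq_sum_walkSeries {e d m : ℕ} {f : ℕ → ℤ} (h0 : f 0 = m)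
    (hs : ∀ n, f (n + 1) = ∑ i ∈ Finset.range m, smallWalk e d n (i + 1)) :
    mk f = ∑ i ∈ Finset.range m, walkSeries e d (i + 1) := by
  rw [sum_walkSeries, mk_eq_of_succ h0 hs]
  simp

theorem walkSeries_of_lt (e : ℕ) {d s : ℕ} (hs : s < d) :
    walkSeries e d s = 1 + X * ∑ i ∈ Finset.range (s + 1), walkSeries e d (i + 1) := by
  rw [← mk_eq_sum_walkSeries (f := fun n => smallWalk e d n s) (by simp [smallWalk_zero])
    fun n => smallWalk_succ e n hs]
  rfl

theorem fibSeries_mul_walkSeries (e : ℕ) {d s : ℕ} (hs : s ≤ d) :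
    fibSeries (s + 1) * walkSeries e d 0 = fibSeries s + X ^ s * walkSeries e d s := by
  cases s with
  | zero => simp [fibSeries]
  | succ s =>
    have h0 := walkSeries_of_lt e (show 0 < d by omega)
    rw [Finset.sum_range_one] at h0
    rw [h0]
    refine fibSeries_mul_of_system (q := fun a => walkSeries e d (a + 1)) fun a ha => ?_
    have h := walkSeries_of_lt e (show a + 1 < d by omega)
    rw [Finset.sum_range_succ] at h
    linear_combination h

theorem mk_returnWeight (e d : ℕ) :
    mk (returnWeight e d) = ∑ i ∈ Finset.range (d - 1), walkSeries e d (i + 1) :=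
  mk_eq_sum_walkSeries rfl fun _ => rfl

theorem fibSeries_mul_walkSeries_self {e d : ℕ} (he : 1 ≤ e) (hd : 1 ≤ d) :
    fibSeries (e + 2) * walkSeries e d d =
      X ^ e * mk 1 ^ e + fibSeries e * (1 + X * mk (returnWeight e d)) := by
  have hself : (mk fun n => smallWalk e d n d) =
      (mk fun n => weightedExt e n 0) + (mk fun n => boundedExt e n 0) * mk (returnWeight e d) := by
    ext n
    simp [coeff_mul, smallWalk_self he hd]
  have hb := fibSeries_mul_boundedExt he
  have hw := fibSeries_mul_weightedExt he
  have hp := fibSeries_add_two e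
  have hX : (X : ℤ⟦X⟧) ≠ 0 := X_ne_zero
  refine mul_left_cancel₀ hX ?_
  rw [walkSeries, hself]
  linear_combination hw + (X * mk (returnWeight e d)) * hb - (1 + X * mk (returnWeight e d)) * hp

theorem fibSeries_mul_walkSeries_zero {e d : ℕ} (he : 1 ≤ e) (hd : 1 ≤ d) :
    fibSeries (e + d + 1) * walkSeries e d 0 = fibSeries (e + d) + X ^ (e + d) * mk 1 ^ e := by
  have hself := fibSeries_mul_walkSeries_self he hd
  have htop := fibSeries_mul_walkSeries e (le_refl d)
  rw [mk_returnWeight] at hself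
  rcases d with _ | _ | m
  · omega
  · have hp := fibSeries_add_two e
    simp only [fibSeries, zero_add, mul_zero, sub_zero, one_mul, pow_one] at htop
    simp only [zero_add, tsub_self, Finset.range_zero, Finset.sum_empty, mul_zero, add_zero,
      mul_one] at hself
    rw [zero_add, htop]
    linear_combination X * hself + hp
  · have hlow := fibSeries_mul_walkSeries e (show m ≤ m + 2 by omega)
    rw [show m + 1 + 1 - 1 = m + 1 by omega, ← walkSeries_of_lt e (by omega)] at hself
    have h1 := fibSeries_mul_sub e (m + 1)
    have h2 := fibSeries_mul_sub e m
    rw [show e + (m + 1 + 1) + 1 = e + (m + 1) + 2 by omega,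
      show e + (m + 1 + 1) = e + m + 2 by omega, ← h1, ← h2]
    linear_combination fibSeries (e + 2) * htop + X ^ (m + 2) * hself -
      X ^ 2 * fibSeries e * hlow

theorem fibSeries_mul_x1 {e d : ℕ} (he : 1 ≤ e) (hd : 1 ≤ d) :
    fibSeries (e + d + 1) * (mk fun n => (x1 (e + d + 1) d n : ℤ)) =
      fibSeries (e + d) + X ^ (e + d) * mk 1 ^ e := by
  rw [← fibSeries_mul_walkSeries_zero he hd, walkSeries, mk_eq_of_succ (c := 1)
    (h := fun n => smallWalk e d n 0), map_one]
  · rw [x1_zero e d he hd, Nat.cast_one]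
  · intro n
    rw [x1_succ he hd, smallWalk, if_neg (by omega)]

theorem fibSeries_mul_catalan (k : ℕ) :
    fibSeries (k + 1) * (mk fun n => (catalan n : ℤ)) =
      fibSeries k + X ^ k * (mk fun n => (catalan n : ℤ)) ^ (k + 1) := by
  set c : ℤ⟦X⟧ := mk fun n => (catalan n : ℤ) with hc
  have hrec : c = 1 + X * c ^ 2 := by
    ext n
    cases n with
    | zero => simp [hc]
    | succ n =>
      rw [map_add, coeff_succ_X_mul, sq, coeff_mul, coeff_one, if_neg n.succ_ne_zero]
      simp [hc, catalan_succ']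
  induction k using Nat.twoStepInduction with
  | zero => simp [fibSeries]
  | one =>
    simp only [fibSeries]
    linear_combination hrec
  | more k ih1 ih2 =>
    rw [fibSeries_add_two (k + 1), fibSeries_add_two k]
    rw [fibSeries_add_two k] at ih2
    linear_combination ih2 - X * ih1 + X ^ (k + 1) * c ^ (k + 1) * hrec

theorem x1_eq_catalan {e d : ℕ} (he : 1 ≤ e) (hd : 1 ≤ d) {n : ℕ} (hn : n ≤ e + d) :
    x1 (e + d + 1) d n = catalan n := by
  have hx := fibSeries_mul_x1 he hd
  have hc := fibSeries_mul_catalan (e + d)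
  set c : ℤ⟦X⟧ := mk fun n => (catalan n : ℤ) with hcdef
  set x : ℤ⟦X⟧ := mk fun n => (x1 (e + d + 1) d n : ℤ) with hxdef
  have hunit : IsUnit (fibSeries (e + d + 1)) := by
    rw [isUnit_iff_constantCoeff, ← coeff_zero_eq_constantCoeff_apply, coeff_fibSeries]
    simp
  have hX : (X : ℤ⟦X⟧) ∣ mk 1 ^ e - c ^ (e + d + 1) := by
    rw [X_dvd_iff]
    rw [map_sub, map_pow, map_pow, hcdef, ← coeff_zero_eq_constantCoeff_apply,
      ← coeff_zero_eq_constantCoeff_apply, coeff_mk, coeff_mk]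
    simp
  have hdvd : (X : ℤ⟦X⟧) ^ (e + d + 1) ∣ x - c := by
    rw [← hunit.dvd_mul_left, mul_sub, hx, hc, add_sub_add_left_eq_sub, ← mul_sub, pow_succ]
    exact mul_dvd_mul_left _ hX
  have h := X_pow_dvd_iff.1 hdvd n (by omega)
  rw [map_sub, sub_eq_zero, hcdef, hxdef, coeff_mk, coeff_mk] at h
  exact_mod_cast h

theorem sum_x1_eq_choose {e d : ℕ} (hd : 1 ≤ d) {n : ℕ} (hn : e + 1 + d + 1 ≤ n) :
    ∑ j ∈ Finset.range (e + 1 + d + 1),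
        (-1 : ℤ) ^ j * ((e + 1 + d - j).choose j : ℤ) * (x1 (e + 1 + d + 1) d (n - j) : ℤ) =
      ((n - d - 1).choose e : ℤ) := by
  have h := congrArg (coeff n) (fibSeries_mul_x1 (Nat.le_add_left 1 e) hd)
  rw [coeff_mul, Finset.Nat.sum_antidiagonal_eq_sum_range_succ_mk, map_add, coeff_X_pow_mul',
    if_pos (by omega), mk_one_pow_eq_mk_choose_add, coeff_mk,
    show e + (n - (e + 1 + d)) = n - d - 1 by omega,
    show e + 1 + d = e + d + 1 by omega, coeff_fibSeries (e + d) n,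
    Nat.choose_eq_zero_of_lt (show e + d - n < n by omega)] at h
  simp only [coeff_fibSeries, coeff_mk, Nat.cast_zero, mul_zero, zero_add] at h
  rw [← h, show e + 1 + d = e + d + 1 by omega]
  refine Finset.sum_subset (Finset.range_mono (by omega)) fun j _ hj => ?_
  rw [Finset.mem_range] at hj
  rw [Nat.choose_eq_zero_of_lt (by omega)]
  simp

end GeneratingFunctions

/-- For `k ≥ 3` and `1 ≤ d ≤ k−2`: for every `n ≥ k`,
`Σ_{j=0}^{k−1} (−1)^j C(k−1−j, j) x_{k,d}^1(n−j) = C(n−d−1, k−d−2)`, and for `0 ≤ n ≤ k−1`,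
`x_{k,d}^1(n) = C(2n,n)/(n+1)`, the `n`-th Catalan number. -/
theorem x1_recurrence (k d : ℕ) (hk : 3 ≤ k) (hd1 : 1 ≤ d) (hd2 : d ≤ k - 2) :
    (∀ n : ℕ, k ≤ n →
        ∑ j ∈ Finset.range k, (-1 : ℤ)^j * ((k-1-j).choose j : ℤ) * (x1 k d (n-j) : ℤ) =
          ((n-d-1).choose (k-d-2) : ℤ)) ∧
      ∀ n : ℕ, n ≤ k - 1 → x1 k d n = Nat.choose (2*n) n / (n+1) := by
  obtain ⟨e, rfl⟩ : ∃ e, k = e + 1 + d + 1 := ⟨k - d - 2, by omega⟩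
  refine ⟨fun n hn => ?_, fun n hn => ?_⟩
  · rw [show e + 1 + d + 1 - d - 2 = e by omega]
    exact sum_x1_eq_choose hd1 hn
  · rw [x1_eq_catalan (Nat.le_add_left 1 e) hd1 hn, catalan_eq_centralBinom_div,
      Nat.centralBinom]
end
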